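/- arXiv:2212.02004 — 3 statements merged into one kernel-verified Lean document; each statement's English description precedes it below -/
import Mathlib

section
/- Let f : S³ → S⁴ be a smooth embedding with image Σ. Then for every connected component C of S⁴ \ Σ, the closure of C, equipped with the subspace topology, is homeomorphic to the closed unit ball Metric.closedBall 0 1 in EuclideanSpace ℝ (Fin 4). (Mazur's Schoenflies theorem: every smoothly embedded 3-sphere in the 4-sphere bounds topological 4-balls on both sides; the paper gives a proof via fibrations of S¹ × S³.) -/
open scoped Manifold
open Metric Set Module

noncomputable section

/-- The 3-sphere: unit sphere in `EuclideanSpace ℝ (Fin 4)`. -/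
abbrev S3 : Type := Metric.sphere (0 : EuclideanSpace ℝ (Fin 4)) 1

/-- The 4-sphere: unit sphere in `EuclideanSpace ℝ (Fin 5)`. -/
abbrev S4 : Type := Metric.sphere (0 : EuclideanSpace ℝ (Fin 5)) 1

instance : Fact (Module.finrank ℝ (EuclideanSpace ℝ (Fin 4)) = 3 + 1) :=
  ⟨finrank_euclideanSpace_fin⟩
instance : Fact (Module.finrank ℝ (EuclideanSpace ℝ (Fin 5)) = 4 + 1) :=
  ⟨finrank_euclideanSpace_fin⟩

/-- A `C^∞` diffeomorphism between two smooth manifolds, as a predicate on maps. -/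
def IsDiffeoB {E H M E' H' M' : Type*} [NormedAddCommGroup E] [NormedSpace ℝ E]
    [TopologicalSpace H] [NormedAddCommGroup E'] [NormedSpace ℝ E'] [TopologicalSpace H']
    (I : ModelWithCorners ℝ E H) (I' : ModelWithCorners ℝ E' H')
    [TopologicalSpace M] [ChartedSpace H M] [TopologicalSpace M'] [ChartedSpace H' M']
    (f : M → M') : Prop :=
  ContMDiff I I' (⊤ : ℕ∞) f ∧ ∃ g : M' → M, ContMDiff I' I (⊤ : ℕ∞) g ∧
    Function.LeftInverse g f ∧ Function.RightInverse g f

/-- A smooth ambient isotopy of a manifold `M`: a family `F : ℝ → M → M` with `F 0 = id`,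
each `F t` a bijection, and both `(t, x) ↦ F t x` and the family of inverses jointly `C^∞`. -/
def IsAmbientIsotopy {E H M : Type*} [NormedAddCommGroup E] [NormedSpace ℝ E]
    [TopologicalSpace H] (I : ModelWithCorners ℝ E H)
    [TopologicalSpace M] [ChartedSpace H M]
    (F : ℝ → M → M) : Prop :=
  F 0 = id ∧ (∀ t, Function.Bijective (F t)) ∧
  ContMDiff (𝓘(ℝ, ℝ).prod I) I (⊤ : ℕ∞) (fun q : ℝ × M => F q.1 q.2) ∧
  ∃ G : ℝ → M → M, (∀ t, Function.LeftInverse (G t) (F t) ∧ Function.RightInverse (G t) (F t)) ∧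
    ContMDiff (𝓘(ℝ, ℝ).prod I) I (⊤ : ℕ∞) (fun q : ℝ × M => G q.1 q.2)

/-- Two subsets of a smooth manifold are smoothly ambiently isotopic. -/
def AmbIsotopic {E H M : Type*} [NormedAddCommGroup E] [NormedSpace ℝ E]
    [TopologicalSpace H] (I : ModelWithCorners ℝ E H)
    [TopologicalSpace M] [ChartedSpace H M]
    (A B : Set M) : Prop :=
  ∃ F : ℝ → M → M, IsAmbientIsotopy I F ∧ (F 1) '' A = B

/-- A smooth embedding of the 3-sphere into a smooth manifold: `C^∞`, injective, a topological
embedding, and an immersion. -/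
def IsS3Embedding {E H M : Type*} [NormedAddCommGroup E] [NormedSpace ℝ E]
    [TopologicalSpace H] (I : ModelWithCorners ℝ E H)
    [TopologicalSpace M] [ChartedSpace H M]
    (f : S3 → M) : Prop :=
  ContMDiff (𝓡 3) I (⊤ : ℕ∞) f ∧ Function.Injective f ∧ Topology.IsEmbedding f ∧
    ∀ x : S3, Function.Injective (mfderiv (𝓡 3) I f x)

section Schoenflies

open Filter Topology

section Radial

/-- A continuous bijection of a proper space which is the identity outside a bounded set is a
homeomorphism. -/
theorem isHomeomorph_of_eq_self_of_le_norm {E : Type*} [NormedAddCommGroup E] [ProperSpace E]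
    {f : E → E} (hc : Continuous f)
    (hb : Function.Bijective f) {M : ℝ} (hM : ∀ y, M ≤ ‖y‖ → f y = y) : IsHomeomorph f := by
  refine isHomeomorph_iff_continuous_isClosedMap_bijective.2 ⟨hc, ?_, hb⟩
  refine IsProperMap.isClosedMap (isProperMap_iff_tendsto_cocompact.2 ⟨hc, ?_⟩)
  refine tendsto_id.congr' ?_
  have : ∀ᶠ y : E in cocompact E, M ≤ ‖y‖ :=
    (tendsto_norm_cocompact_atTop (E := E)).eventually_ge_atTop M
  filter_upwards [this] with y hy
  simp [hM y hy]

variable {E : Type*} [NormedAddCommGroup E] [NormedSpace ℝ E] [ProperSpace E]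

/-- A radial homeomorphism, equal to the identity near `0` and near infinity, which squeezes a
given ball into a given neighbourhood of `0`. -/
theorem exists_squeeze {R η : ℝ} (hR : 0 < R) (hη : 0 < η) :
    ∃ s : E ≃ₜ E, ∃ M ρ : ℝ, 0 < ρ ∧ (∀ y, M ≤ ‖y‖ → s y = y) ∧ (∀ y, ‖y‖ ≤ ρ → s y = y) ∧
      ∀ y, ‖y‖ ≤ R → ‖s y‖ < η := by
  set a : ℝ := η / 2 with ha
  set κ : ℝ := η / (4 * R) with hκ
  have ha0 : 0 < a := by positivity
  have hκ0 : 0 < κ := by positivity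
  have hκR : κ * R = η / 4 := by rw [hκ]; field_simp
  set M : ℝ := 2 * R + a with hMdef
  set h : ℝ → ℝ := fun r => min r (max (a + κ * r) (2 * r - M)) with hh
  have hmono : StrictMono h := by
    intro r s hrs
    have h1 : a + κ * r < a + κ * s := by gcongr
    have h2 : 2 * r - M < 2 * s - M := by linarith
    exact min_lt_min hrs (max_lt_max h1 h2)
  have hcont : Continuous h := by fun_prop
  have hsmall : ∀ r, 0 ≤ r → r ≤ a → h r = r := fun r h0 hr =>
    min_eq_left (le_max_of_le_left (by nlinarith [mul_nonneg hκ0.le h0]))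
  have hbig : ∀ r, M ≤ r → h r = r := fun r hr =>
    min_eq_left (le_max_of_le_right (by linarith))
  have h0 : h 0 = 0 := hsmall 0 le_rfl ha0.le
  have hpos : ∀ r, 0 < r → 0 < h r := fun r hr => h0 ▸ hmono hr
  have hR' : ∀ r, 0 ≤ r → r ≤ R → h r < η := by
    intro r hr0 hr
    refine min_lt_of_right_lt (max_lt ?_ ?_)
    · nlinarith
    · linarith
  set l : ℝ → ℝ := fun r => h (max r a) / max r a with hl
  have hlpos : ∀ r, 0 < l r := fun r =>
    div_pos (hpos _ (lt_max_of_lt_right ha0)) (lt_max_of_lt_right ha0)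
  have hlcont : Continuous l := by
    refine Continuous.div (by fun_prop) (by fun_prop) fun r => (lt_max_of_lt_right ha0).ne'
  have hlr : ∀ r, 0 ≤ r → l r * r = h r := by
    intro r hr
    rcases le_total r a with hra | hra
    · simp only [hl, max_eq_right hra]
      rw [hsmall a ha0.le le_rfl, div_self ha0.ne', one_mul, hsmall r hr hra]
    · simp only [hl, max_eq_left hra]
      field_simp [(ha0.trans_le hra).ne']
  set f : E → E := fun y => l ‖y‖ • y with hf
  have hfn : ∀ y, ‖f y‖ = h ‖y‖ := fun y => by
    rw [hf]; simp only [norm_smul, Real.norm_eq_abs, abs_of_pos (hlpos _), hlr _ (norm_nonneg y)]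
  have hfid : ∀ y, h ‖y‖ = ‖y‖ → f y = y := by
    intro y hy
    rcases eq_or_ne y 0 with rfl | hy0
    · simp [hf]
    · have h1 : l ‖y‖ * ‖y‖ = ‖y‖ := by rw [hlr _ (norm_nonneg y), hy]
      have h2 : l ‖y‖ = 1 := by
        have := norm_pos_iff.2 hy0
        nlinarith [mul_right_cancel₀ this.ne' (h1.trans (one_mul _).symm)]
      simp [hf, h2]
  have hfc : Continuous f := by fun_prop
  have hinj : Function.Injective f := by
    intro x y hxy
    have hn : ‖x‖ = ‖y‖ := hmono.injective (by rw [← hfn, ← hfn, hxy])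
    have : l ‖y‖ • x = l ‖y‖ • y := by simpa [hf, hn] using hxy
    exact smul_right_injective E (hlpos _).ne' this
  have hsurj : Function.Surjective f := by
    intro y
    rcases eq_or_ne y 0 with rfl | hy0
    · exact ⟨0, by simp [hf]⟩
    have hyp := norm_pos_iff.2 hy0
    obtain ⟨r, hr, hry⟩ : ∃ r ∈ Icc 0 (max M ‖y‖), h r = ‖y‖ := by
      refine intermediate_value_Icc (le_max_of_le_right hyp.le) hcont.continuousOn ⟨?_, ?_⟩
      · rw [h0]; exact hyp.le
      · rw [hbig _ (le_max_left _ _)]; exact le_max_right _ _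
    refine ⟨(r / ‖y‖) • y, ?_⟩
    have hnr : ‖(r / ‖y‖) • y‖ = r := by
      rw [norm_smul, Real.norm_eq_abs, abs_of_nonneg (div_nonneg hr.1 hyp.le)]; field_simp
    simp only [hf, hnr, smul_smul]
    rw [← mul_div_assoc, hlr r hr.1, hry, div_self hyp.ne', one_smul]
  have hid : ∀ y, M ≤ ‖y‖ → f y = y := fun y hy => hfid y (hbig _ hy)
  refine ⟨(isHomeomorph_of_eq_self_of_le_norm hfc ⟨hinj, hsurj⟩ hid).homeomorph, M, a, ha0,
    hid, fun y hy => hfid y (hsmall _ (norm_nonneg y) hy), fun y hy => ?_⟩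
  change ‖f y‖ < η
  rw [hfn]
  exact hR' _ (norm_nonneg y) hy

/-- A compactly supported homeomorphism of a nontrivial normed space which moves the origin. -/
theorem exists_homeomorph_zero_ne [Nontrivial E] :
    ∃ T : E ≃ₜ E, T 0 ≠ 0 ∧ ∀ y, 1 ≤ ‖y‖ → T y = y := by
  obtain ⟨v, hv⟩ : ∃ v : E, ‖v‖ = 1 / 2 := exists_norm_eq E (by norm_num)
  have hv0 : v ≠ 0 := by rintro rfl; norm_num at hv
  set f : E → E := fun y => y - max 0 (1 - ‖y‖) • v with hf
  have happ : ApproximatesLinearOn f ((ContinuousLinearEquiv.refl ℝ E : E ≃L[ℝ] E) : E →L[ℝ] E)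
      univ (1 / 2 : NNReal) := by
    intro x _ y _
    have h1 : f x - f y - (x - y) = (max 0 (1 - ‖y‖) - max 0 (1 - ‖x‖)) • v := by
      simp only [hf, sub_smul]; abel
    have h2 : |max 0 (1 - ‖y‖) - max 0 (1 - ‖x‖)| ≤ ‖x - y‖ := by
      refine (abs_max_sub_max_le_max _ _ _ _).trans (max_le (by simp) ?_)
      have : (1 - ‖y‖) - (1 - ‖x‖) = ‖x‖ - ‖y‖ := by ring
      rw [this]; exact abs_norm_sub_norm_le x y
    simp only [ContinuousLinearEquiv.coe_coe, ContinuousLinearEquiv.refl_apply]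
    change ‖f x - f y - (x - y)‖ ≤ _
    rw [h1, norm_smul, hv, Real.norm_eq_abs]
    push_cast
    nlinarith
  have hc : ((1 / 2 : NNReal)) < ‖((ContinuousLinearEquiv.refl ℝ E).symm : E →L[ℝ] E)‖₊⁻¹ := by
    have : ‖((ContinuousLinearEquiv.refl ℝ E).symm : E →L[ℝ] E)‖₊ = 1 := by
      ext; exact ContinuousLinearMap.norm_id
    rw [this, inv_one]; exact NNReal.half_lt_self one_ne_zero
  refine ⟨happ.toHomeomorph f (Or.inr hc), ?_, ?_⟩
  · change f 0 ≠ 0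
    simp [hf, hv0]
  · intro y hy
    change f y = y
    simp [hf, max_eq_left (sub_nonpos.2 hy)]

end Radial

section Shrinking

variable {E X : Type*} [TopologicalSpace E]

/-- A homeomorphism of an open cell with compact support extends by the identity. -/
theorem Topology.IsOpenEmbedding.exists_homeomorph_extend [TopologicalSpace X] [T2Space X]
    {F : E → X} (hF : IsOpenEmbedding F) (s : E ≃ₜ E) {K : Set E} (hK : IsCompact K)
    (hs : ∀ y ∉ K, s y = y) :
    ∃ φ : X ≃ₜ X, (∀ y, φ (F y) = F (s y)) ∧ ∀ x ∉ range F, φ x = x := by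
  have key : ∀ s : E ≃ₜ E, (∀ y ∉ K, s y = y) → Continuous (Function.extend F (F ∘ s) id) := by
    intro s hs
    rw [continuous_iff_continuousAt]
    intro x
    by_cases hx : x ∈ range F
    · obtain ⟨y, rfl⟩ := hx
      rw [← hF.continuousAt_iff, Function.extend_comp hF.injective]
      exact (hF.continuous.comp s.continuous).continuousAt
    · have hcl : IsClosed (F '' K) := (hK.image hF.continuous).isClosed
      have hxK : x ∈ (F '' K)ᶜ := fun h => hx (image_subset_range _ _ h)
      refine continuousAt_id.congr ?_
      filter_upwards [hcl.isOpen_compl.mem_nhds hxK] with w hw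
      by_cases hwF : ∃ y, F y = w
      · obtain ⟨y, rfl⟩ := hwF
        have hy : y ∉ K := fun h => hw (mem_image_of_mem F h)
        simp [hF.injective.extend_apply, hs y hy]
      · simp [Function.extend_apply' _ _ _ hwF]
  have hs' : ∀ y ∉ K, s.symm y = y := fun y hy => by
    rw [Homeomorph.symm_apply_eq, hs y hy]
  have inv : ∀ s : E ≃ₜ E, Function.LeftInverse (Function.extend F (F ∘ s.symm) id)
      (Function.extend F (F ∘ s) id) := by
    intro s x
    by_cases hx : ∃ y, F y = x
    · obtain ⟨y, rfl⟩ := hx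
      simp [hF.injective.extend_apply]
    · simp [Function.extend_apply' _ _ _ hx]
  refine ⟨⟨⟨_, _, inv s, ?_⟩, key s hs, key s.symm hs'⟩, fun y => ?_, fun x hx => ?_⟩
  · exact inv s.symm
  · exact hF.injective.extend_apply _ _ _
  · exact Function.extend_apply' _ _ _ hx

end Shrinking

theorem IsCompact.exists_subset_image_closedBall {E X : Type*} [NormedAddCommGroup E]
    [TopologicalSpace X] {F : E → X}
    (hF : IsOpenEmbedding F) {A : Set X} (hA : IsCompact A) (hAF : A ⊆ range F) :
    ∃ R > 0, A ⊆ F '' closedBall 0 R := by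
  have hc : IsCompact (F ⁻¹' A) := hF.isInducing.isCompact_preimage' hA hAF
  obtain ⟨R, hR, h⟩ := hc.isBounded.subset_closedBall_lt 0 0
  refine ⟨R, hR, fun x hx => ?_⟩
  obtain ⟨y, rfl⟩ := hAF hx
  exact ⟨y, h hx, rfl⟩

section Cellular

variable {E X : Type*} [NormedAddCommGroup E] [NormedSpace ℝ E] [ProperSpace E]

/-- A set is cellular (modelled on `E`) if it has arbitrarily small open cell neighbourhoods. -/
def IsCellular (E : Type*) [TopologicalSpace E] [TopologicalSpace X] (A : Set X) : Prop :=
  ∀ U : Set X, IsOpen U → A ⊆ U → ∃ F : E → X, IsOpenEmbedding F ∧ A ⊆ range F ∧ range F ⊆ U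

/-- Cellular compact sets can be shrunk by homeomorphisms supported near them. -/
theorem IsCellular.exists_homeomorph_shrink [MetricSpace X] {A : Set X} (hA : IsCellular E A)
    (hc : IsCompact A) {U : Set X} (hU : IsOpen U) (hAU : A ⊆ U) {ε : ℝ} (hε : 0 < ε) :
    ∃ φ : X ≃ₜ X, (∀ x ∉ U, φ x = x) ∧ ∀ x ∈ A, ∀ y ∈ A, dist (φ x) (φ y) < ε := by
  obtain ⟨F, hF, hAF, hFU⟩ := hA U hU hAU
  obtain ⟨R, hR, hAR⟩ := hc.exists_subset_image_closedBall hF hAF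
  obtain ⟨η, hη, hball⟩ :=
    Metric.continuousAt_iff.1 hF.continuous.continuousAt (ε / 2) (half_pos hε)
  obtain ⟨s, M, -, -, hM, -, hsR⟩ := exists_squeeze (E := E) hR hη
  obtain ⟨φ, hφ, hφ'⟩ := hF.exists_homeomorph_extend s (isCompact_closedBall (0 : E) M)
    fun y hy => hM y (by simpa using (not_le.1 (fun h => hy (by simpa using h))).le)
  refine ⟨φ, fun x hx => hφ' x fun h => hx (hFU h), ?_⟩
  have : ∀ x ∈ A, dist (φ x) (F 0) < ε / 2 := by
    intro x hx
    obtain ⟨y, hy, rfl⟩ := hAR hx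
    rw [hφ]
    refine hball ?_
    simpa using hsR y (by simpa using hy)
  intro x hx y hy
  have := dist_triangle_right (φ x) (φ y) (F 0)
  linarith [‹∀ x ∈ A, dist (φ x) (F 0) < ε / 2› x hx, ‹∀ x ∈ A, dist (φ x) (F 0) < ε / 2› y hy]

end Cellular

section NhdsMap

theorem map_nhds_congr {X Y : Type*} [TopologicalSpace X] [TopologicalSpace Y] {f g : X → Y} {x : X}
    (h : map f (𝓝 x) = 𝓝 (f x)) (hfg : g =ᶠ[𝓝 x] f) : map g (𝓝 x) = 𝓝 (g x) := by
  rw [map_congr hfg, h, hfg.eq_of_nhds]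

theorem map_nhds_comp {X Y Z : Type*} [TopologicalSpace X] [TopologicalSpace Y]
    [TopologicalSpace Z] {g : Y → Z} {f : X → Y} {x : X}
    (hg : map g (𝓝 (f x)) = 𝓝 (g (f x))) (hf : map f (𝓝 x) = 𝓝 (f x)) :
    map (g ∘ f) (𝓝 x) = 𝓝 ((g ∘ f) x) := by
  rw [← Filter.map_map, hf, hg, Function.comp]

theorem isOpenEmbedding_of_map_nhds {X Y : Type*} [TopologicalSpace X] [TopologicalSpace Y]
    {f : X → Y} (hi : Function.Injective f) (h : ∀ x, map f (𝓝 x) = 𝓝 (f x)) :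
    IsOpenEmbedding f :=
  IsOpenEmbedding.of_continuous_injective_isOpenMap
    (continuous_iff_continuousAt.2 fun x => (h x).le) hi (isOpenMap_iff_nhds_le.2 fun x => (h x).ge)

end NhdsMap

theorem div_one_add_lt_div_one_add {a b : ℝ} (ha : 0 ≤ a) (hb : 0 ≤ b) :
    a / (1 + a) < b / (1 + b) ↔ a < b := by
  rw [div_lt_div_iff₀ (by positivity) (by positivity)]
  constructor <;> intro h <;> nlinarith

/-- An open embedding `j` of the punctured space `E ∖ {0}` in `X`, together with a function `v`
separating the two sides of the complement of the image. -/
structure PolarCollar (E X : Type*) [NormedAddCommGroup E] [TopologicalSpace X] where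
  /-- the embedding, with a junk value at `0` -/
  j : E → X
  /-- the height function -/
  v : X → ℝ
  injOn : InjOn j {0}ᶜ
  map_nhds : ∀ y ≠ 0, map j (𝓝 y) = 𝓝 (j y)
  continuous_v : Continuous v
  v_j : ∀ y ≠ 0, v (j y) = ‖y‖ / (1 + ‖y‖)
  exists_j : ∀ x, 0 < v x → v x < 1 → ∃ y ≠ 0, j y = x

namespace PolarCollar

variable {E X : Type*} [NormedAddCommGroup E]

section Basic

variable [TopologicalSpace X] (c : PolarCollar E X)

/-- The inner core: the points which the polar collar shrinks to when the radius tends to `0`. -/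
def core : Set X := {x | c.v x ≤ 0}

theorem isClosed_core : IsClosed c.core := isClosed_le c.continuous_v continuous_const

theorem v_j_pos {y : E} (hy : y ≠ 0) : 0 < c.v (c.j y) := by
  have := norm_pos_iff.2 hy
  rw [c.v_j y hy]; positivity

theorem v_j_lt_one {y : E} (hy : y ≠ 0) : c.v (c.j y) < 1 := by
  have := norm_pos_iff.2 hy
  rw [c.v_j y hy, div_lt_one (by positivity)]; linarith

theorem j_notMem_core {y : E} (hy : y ≠ 0) : c.j y ∉ c.core := fun h => (c.v_j_pos hy).not_ge h

/-- The inverse of the polar embedding. -/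
def inv (x : X) : E := Function.invFunOn c.j {0}ᶜ x

theorem inv_j {y : E} (hy : y ≠ 0) : c.inv (c.j y) = y :=
  c.injOn.leftInvOn_invFunOn hy

theorem map_inv_nhds {y : E} (hy : y ≠ 0) : map c.inv (𝓝 (c.j y)) = 𝓝 (c.inv (c.j y)) := by
  rw [← c.map_nhds y hy, Filter.map_map, c.inv_j hy]
  have : c.inv ∘ c.j =ᶠ[𝓝 y] id := by
    filter_upwards [isOpen_ne.mem_nhds hy] with z hz using c.inv_j hz
  rw [map_congr this, map_id]

theorem v_j_lt {y : E} (hy : y ≠ 0) {r : ℝ} (hr : 0 ≤ r) :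
    c.v (c.j y) < r / (1 + r) ↔ ‖y‖ < r := by
  rw [c.v_j y hy, div_one_add_lt_div_one_add (norm_nonneg y) hr]

theorem lt_v_j {y : E} (hy : y ≠ 0) {r : ℝ} (hr : 0 ≤ r) :
    r / (1 + r) < c.v (c.j y) ↔ r < ‖y‖ := by
  rw [c.v_j y hy, div_one_add_lt_div_one_add hr (norm_nonneg y)]

theorem v_le_half_iff {y : E} (hy : y ≠ 0) : c.v (c.j y) ≤ 1 / 2 ↔ ‖y‖ ≤ 1 := by
  have := c.lt_v_j hy zero_le_one
  norm_num at this
  rw [← not_lt, ← not_lt, this]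

theorem v_lt_half_iff {y : E} (hy : y ≠ 0) : c.v (c.j y) < 1 / 2 ↔ ‖y‖ < 1 := by
  have := c.v_j_lt hy zero_le_one
  norm_num at this
  rw [this]

theorem exists_subset_of_core_subset [CompactSpace X] {U : Set X} (hU : IsOpen U)
    (hc : c.core ⊆ U) : ∃ r > 0, ∀ x, c.v x < r / (1 + r) → x ∈ U := by
  rcases Uᶜ.eq_empty_or_nonempty with h | h
  · exact ⟨1, one_pos, fun x _ => by simp [compl_empty_iff.1 h]⟩
  obtain ⟨x, hxU, hx⟩ := hU.isClosed_compl.isCompact.exists_isMinOn h c.continuous_v.continuousOn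
  have hvx : 0 < c.v x := lt_of_not_ge fun h => hxU (hc h)
  refine ⟨c.v x, hvx, fun y hy => by_contra fun hyU => ?_⟩
  have h1 : c.v x ≤ c.v y := hx hyU
  have h2 : c.v x / (1 + c.v x) ≤ c.v x := div_le_self hvx.le (by linarith)
  linarith

theorem core_nonempty [CompactSpace X] [NormedSpace ℝ E] [Nontrivial E] : c.core.Nonempty := by
  by_contra h
  rw [not_nonempty_iff_eq_empty] at h
  obtain ⟨r, hr, hrU⟩ := c.exists_subset_of_core_subset isOpen_empty h.le
  obtain ⟨y, hy⟩ : ∃ y : E, ‖y‖ = r / 2 := exists_norm_eq E (by positivity)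
  have hy0 : y ≠ 0 := norm_pos_iff.1 (by rw [hy]; positivity)
  exact hrU (c.j y) ((c.v_j_lt hy0 hr.le).2 (by rw [hy]; linarith))

open Classical in
/-- The self-map of `X` induced by a self-map of `E`, equal to the identity outside the polar
collar and the core. -/
def lift (T : E → E) (x : X) : X := if 1 ≤ c.v x then x else c.j (T (c.inv x))

theorem lift_of_one_le (T : E → E) {x : X} (hx : 1 ≤ c.v x) : c.lift T x = x := if_pos hx

theorem lift_j (T : E → E) {y : E} (hy : y ≠ 0) : c.lift T (c.j y) = c.j (T y) := by
  rw [lift, if_neg (not_le.2 (c.v_j_lt_one hy)), c.inv_j hy]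

theorem map_lift_nhds_j (T : E ≃ₜ E) {y : E} (hy : y ≠ 0) (hT : T y ≠ 0) :
    map (c.lift T) (𝓝 (c.j y)) = 𝓝 (c.lift T (c.j y)) := by
  have h1 : map (T ∘ c.inv) (𝓝 (c.j y)) = 𝓝 ((T ∘ c.inv) (c.j y)) :=
    map_nhds_comp (T.map_nhds_eq _) (c.map_inv_nhds hy)
  have h2 : map (c.j ∘ (T ∘ c.inv)) (𝓝 (c.j y)) = 𝓝 ((c.j ∘ (T ∘ c.inv)) (c.j y)) :=
    map_nhds_comp (c.map_nhds _ (by simpa [c.inv_j hy] using hT)) h1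
  refine map_nhds_congr h2 ?_
  have : c.v ⁻¹' Iio 1 ∈ 𝓝 (c.j y) :=
    (isOpen_Iio.preimage c.continuous_v).mem_nhds (c.v_j_lt_one hy)
  filter_upwards [this] with x hx
  simp [lift, not_le.2 (show c.v x < 1 from hx)]

theorem map_lift_nhds_of_one_le (T : E ≃ₜ E) {M : ℝ} (hM : 0 < M) (hT : ∀ y, M ≤ ‖y‖ → T y = y)
    {x : X} (hx : 1 ≤ c.v x) : map (c.lift T) (𝓝 x) = 𝓝 (c.lift T x) := by
  refine map_nhds_congr (f := id) (by simp) ?_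
  have hlt : M / (1 + M) < 1 := by rw [div_lt_one (by positivity)]; linarith
  have : c.v ⁻¹' Ioi (M / (1 + M)) ∈ 𝓝 x :=
    (isOpen_Ioi.preimage c.continuous_v).mem_nhds (hlt.trans_le hx)
  filter_upwards [this] with w hw
  rcases le_or_gt 1 (c.v w) with h | h
  · exact c.lift_of_one_le _ h
  · have hw' : M / (1 + M) < c.v w := hw
    obtain ⟨y, hy, rfl⟩ := c.exists_j w (lt_of_le_of_lt (by positivity) hw') h
    rw [c.lift_j _ hy, hT y ((c.lt_v_j hy hM.le).1 hw').le, id]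

theorem notMem_core_cases {x : X} (hx : x ∉ c.core) : 1 ≤ c.v x ∨ ∃ y ≠ 0, c.j y = x := by
  rcases le_or_gt 1 (c.v x) with h | h
  · exact Or.inl h
  · exact Or.inr (c.exists_j x (not_le.1 hx) h)

theorem lift_symm_lift (T : E ≃ₜ E) {x : X} (hx : x ∉ c.core) (hne : x ≠ c.j (T.symm 0)) :
    c.lift T.symm (c.lift T x) = x := by
  rcases c.notMem_core_cases hx with h | ⟨y, hy, rfl⟩
  · rw [c.lift_of_one_le T h, c.lift_of_one_le _ h]
  · rw [c.lift_j _ hy, c.lift_j, T.symm_apply_apply]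
    exact fun h => hne (by rw [← h, T.symm_apply_apply])

theorem lift_ne (T : E ≃ₜ E) {x : X} (hT : T 0 ≠ 0) (hx : x ∉ c.core)
    (hne : x ≠ c.j (T.symm 0)) : c.lift T x ≠ c.j (T 0) := by
  rcases c.notMem_core_cases hx with h | ⟨y, hy, rfl⟩
  · rw [c.lift_of_one_le T h]
    rintro rfl
    exact (c.v_j_lt_one hT).not_ge h
  · rw [c.lift_j _ hy]
    have hTy : T y ≠ 0 := fun h => hne (by rw [← h, T.symm_apply_apply])
    intro h
    exact hy (T.injective (c.injOn hTy hT h))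

theorem map_lift_nhds (T : E ≃ₜ E) {M : ℝ} (hM : 0 < M) (hT : ∀ y, M ≤ ‖y‖ → T y = y)
    {x : X} (hx : x ∉ c.core) (hne : x ≠ c.j (T.symm 0)) :
    map (c.lift T) (𝓝 x) = 𝓝 (c.lift T x) := by
  rcases c.notMem_core_cases hx with h | ⟨y, hy, rfl⟩
  · exact c.map_lift_nhds_of_one_le T hM hT h
  · exact c.map_lift_nhds_j T hy fun h => hne (by rw [← h, T.symm_apply_apply])

end Basic

end PolarCollar

/-- In a space `X` like the sphere, the complement of each point is a cell, which can be centred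
at any other point. -/
def HasPuncturedCells (E X : Type*) [Zero E] [TopologicalSpace E] [TopologicalSpace X] : Prop :=
  ∀ z p : X, z ≠ p → ∃ e : E → X, IsOpenEmbedding e ∧ range e = {z}ᶜ ∧ e 0 = p

namespace PolarCollar

variable {E X : Type*} [NormedAddCommGroup E] [InnerProductSpace ℝ E] [ProperSpace E] [Nontrivial E]
  [TopologicalSpace X] [CompactSpace X] [T2Space X] (c : PolarCollar E X)

/-- The core of a polar collar in a space with cellular point complements is cellular. -/
theorem isCellular_core (hX : HasPuncturedCells E X) : IsCellular E c.core := by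
  intro U hU hcU
  obtain ⟨T, hT0, hTM⟩ := exists_homeomorph_zero_ne (E := E)
  have hc0 : T.symm 0 ≠ 0 := fun h => hT0 (by rw [← h, T.apply_symm_apply, h])
  have hTM' : ∀ y, 1 ≤ ‖y‖ → T.symm y = y := fun y hy => by rw [Homeomorph.symm_apply_eq, hTM y hy]
  set z := c.j (T.symm 0) with hz
  set p := c.j (T 0) with hp
  have hpcore : p ∉ c.core := c.j_notMem_core hT0
  have hzcore : z ∉ c.core := c.j_notMem_core hc0
  obtain ⟨a, ha⟩ := c.core_nonempty
  have haz : z ≠ a := fun h => hzcore (h ▸ ha)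
  have hap : a ≠ p := fun h => hpcore (h ▸ ha)
  -- a chart covering the core
  obtain ⟨e₀, he₀, he₀r, -⟩ := hX z a haz
  obtain ⟨R₀, hR₀, hcore⟩ := c.isClosed_core.isCompact.exists_subset_image_closedBall he₀
    (by rw [he₀r]; intro x hx h; exact hzcore (by rwa [← mem_singleton_iff.1 h]))
  set b := OpenPartialHomeomorph.univBall (0 : E) (R₀ + 1) with hb
  have hbe : IsOpenEmbedding b := b.isOpenEmbedding (OpenPartialHomeomorph.univBall_source _ _)
  have hbr : range b = ball 0 (R₀ + 1) := by
    rw [← image_univ, ← OpenPartialHomeomorph.univBall_source (0 : E) (R₀ + 1), ← hb,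
      b.image_source_eq_target, hb, OpenPartialHomeomorph.univBall_target _ (by positivity)]
  set e := e₀ ∘ b with he
  have hee : IsOpenEmbedding e := he₀.comp hbe
  have hcoree : c.core ⊆ range e := by
    rw [he, range_comp, hbr]
    exact hcore.trans (image_mono (closedBall_subset_ball (by linarith)))
  set Q₀ := e₀ '' closedBall 0 (R₀ + 1) with hQ₀
  have hQ₀c : IsClosed Q₀ := ((isCompact_closedBall _ _).image he₀.continuous).isClosed
  have hzQ₀ : z ∉ Q₀ := fun h => by
    have : z ∈ range e₀ := image_subset_range _ _ h
    rw [he₀r] at this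
    exact this rfl
  have heQ₀ : ∀ y, e y ∈ Q₀ := fun y =>
    mem_image_of_mem _ (ball_subset_closedBall (hbr ▸ mem_range_self y))
  have hez : ∀ y, e y ≠ z := fun y h => hzQ₀ (h ▸ heQ₀ y)
  -- the lifted homeomorphism moves `Q₀` away from the core
  obtain ⟨r, hr, hrQ⟩ : ∃ r > 0, ∀ y, ‖y‖ < r → c.j (T.symm y) ∉ Q₀ := by
    have hcont : ContinuousAt (c.j ∘ T.symm) 0 :=
      ContinuousAt.comp (c.map_nhds _ hc0).le T.symm.continuous.continuousAt
    obtain ⟨r, hr, h⟩ := Metric.mem_nhds_iff.1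
      (hcont.preimage_mem_nhds (hQ₀c.isOpen_compl.mem_nhds hzQ₀))
    exact ⟨r, hr, fun y hy => h (by simpa using hy)⟩
  have hr1 : r / (1 + r) < 1 := by rw [div_lt_one (by positivity)]; linarith
  have hQτ : ∀ x ∈ Q₀, x ∉ c.core → r / (1 + r) ≤ c.v (c.lift T x) := by
    intro x hx hxc
    rcases c.notMem_core_cases hxc with h | ⟨y, hy, rfl⟩
    · rw [c.lift_of_one_le _ h]; exact hr1.le.trans h
    · have hTy : T y ≠ 0 := fun h => hzQ₀ (by rwa [hz, ← h, T.symm_apply_apply])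
      rw [c.lift_j _ hy]
      by_contra! hlt
      refine hrQ (T y) ((c.v_j_lt hTy hr.le).1 hlt) ?_
      rwa [T.symm_apply_apply]
  -- a small neighbourhood of `p`
  obtain ⟨r₁, hr₁, hr₁U⟩ := c.exists_subset_of_core_subset hU hcU
  obtain ⟨ρ₁, hρ₁, hρ₁T⟩ : ∃ ρ > 0, ∀ y, ‖y‖ < ρ → T y ≠ 0 ∧ ‖y‖ < r₁ := by
    have h1 : {y : E | T y ≠ 0} ∈ 𝓝 0 :=
      (isOpen_ne.preimage T.continuous).mem_nhds hT0
    obtain ⟨ρ, hρ, h⟩ := Metric.mem_nhds_iff.1 (inter_mem h1 (ball_mem_nhds 0 hr₁))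
    refine ⟨ρ, hρ, fun y hy => ?_⟩
    have := h (show y ∈ ball 0 ρ by simpa using hy)
    exact ⟨this.1, by simpa using this.2⟩
  have hjT : map (c.j ∘ T) (𝓝 0) = 𝓝 p := map_nhds_comp (c.map_nhds _ hT0) (T.map_nhds_eq 0)
  have hN : (c.j ∘ T) '' ball 0 ρ₁ ∈ 𝓝 p := by
    rw [← hjT]; exact image_mem_map (ball_mem_nhds _ hρ₁)
  -- the squeezing homeomorphism
  obtain ⟨e₁, he₁, he₁r, he₁0⟩ := hX a p hap
  have hQc : IsCompact {x | r / (1 + r) ≤ c.v x} :=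
    (isClosed_le continuous_const c.continuous_v).isCompact
  obtain ⟨R, hR, hQR⟩ := hQc.exists_subset_image_closedBall he₁ (by
    rw [he₁r]
    rintro x hx rfl
    have : 0 < r / (1 + r) := by positivity
    exact (this.trans_le hx).not_ge ha)
  obtain ⟨η, hη, hηN⟩ : ∃ η > 0, ∀ y, ‖y‖ < η → e₁ y ∈ (c.j ∘ T) '' ball 0 ρ₁ := by
    obtain ⟨η, hη, h⟩ := Metric.mem_nhds_iff.1
      (he₁.continuous.continuousAt.preimage_mem_nhds (by rwa [he₁0]))
    exact ⟨η, hη, fun y hy => h (by simpa using hy)⟩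
  obtain ⟨s, M, ρ, hρ, hsM, hsρ, hsR⟩ := exists_squeeze (E := E) hR hη
  obtain ⟨k, hk, hk'⟩ := he₁.exists_homeomorph_extend s (isCompact_closedBall (0 : E) M)
    fun y hy => hsM y (by simpa using (not_le.1 (fun h => hy (by simpa using h))).le)
  have hkQ : ∀ x, r / (1 + r) ≤ c.v x → k x ∈ (c.j ∘ T) '' ball 0 ρ₁ := by
    intro x hx
    obtain ⟨y, hy, rfl⟩ := hQR hx
    rw [hk]
    exact hηN _ (hsR y (by simpa using hy))
  have hkp : k p = p := by rw [← he₁0, hk, hsρ 0 (by simpa using hρ.le)]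
  have hknear : ∀ᶠ x in 𝓝 p, k x = x := by
    rw [← he₁0, ← he₁.map_nhds_eq, eventually_map]
    filter_upwards [ball_mem_nhds (0 : E) hρ] with y hy
    rw [hk, hsρ y (by simpa using (mem_ball.1 hy).le)]
  obtain ⟨ρ₂, hρ₂, hρ₂k⟩ : ∃ ρ₂ > 0, ∀ y, ‖y‖ < ρ₂ → k (c.j (T y)) = c.j (T y) ∧ ‖y‖ < ρ₁ := by
    rw [← hjT, eventually_map] at hknear
    obtain ⟨ρ, hρ, h⟩ := Metric.mem_nhds_iff.1 (inter_mem hknear (ball_mem_nhds 0 hρ₁))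
    refine ⟨ρ, hρ, fun y hy => ?_⟩
    have := h (show y ∈ ball 0 ρ by simpa using hy)
    exact ⟨this.1, by simpa using this.2⟩
  set G : X → X := fun x => c.lift T.symm (k (c.lift T x)) with hG
  have hmain : ∀ x ∈ Q₀, x ∉ c.core → k (c.lift T x) ∉ c.core ∧ k (c.lift T x) ≠ p ∧
      c.lift T.symm (k.symm (c.lift T (G x))) = x ∧ G x ∉ c.core ∧ G x ∈ U ∧
      map G (𝓝 x) = 𝓝 (G x) := by
    intro x hx hxc
    have hxz : x ≠ c.j (T.symm 0) := fun h => hzQ₀ (by rwa [hz, ← h])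
    have hwp : c.lift T x ≠ p := c.lift_ne T hT0 hxc hxz
    have hkwp : k (c.lift T x) ≠ p := fun h => hwp (k.injective (h.trans hkp.symm))
    obtain ⟨y, hy, hyk⟩ := hkQ _ (hQτ x hx hxc)
    have hy' : ‖y‖ < ρ₁ := by simpa using hy
    have hy0 : y ≠ 0 := by
      rintro rfl
      exact hkwp hyk.symm
    have hkc : k (c.lift T x) ∉ c.core := by
      rw [← hyk]; exact c.j_notMem_core (hρ₁T y hy').1
    have hGx : G x = c.j y := by
      rw [hG]; simp only [← hyk, Function.comp]
      rw [c.lift_j _ (hρ₁T y hy').1, T.symm_apply_apply]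
    refine ⟨hkc, hkwp, ?_, ?_, ?_, ?_⟩
    · rw [hGx, c.lift_j _ hy0]
      have : c.j (T y) = k (c.lift T x) := hyk
      rw [this, k.symm_apply_apply, c.lift_symm_lift T hxc hxz]
    · rw [hGx]; exact c.j_notMem_core hy0
    · rw [hGx]; exact hr₁U _ ((c.v_j_lt hy0 hr₁.le).2 (hρ₁T y hy').2)
    · have h1 := c.map_lift_nhds T one_pos hTM hxc hxz
      have h2 : map (k ∘ c.lift T) (𝓝 x) = 𝓝 ((k ∘ c.lift T) x) :=
        map_nhds_comp (k.map_nhds_eq _) h1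
      have h3 := c.map_lift_nhds T.symm one_pos hTM' hkc (by simpa using hkwp)
      exact map_nhds_comp (f := k ∘ c.lift T) h3 h2
  have hGnear : ∀ x, c.v x < ρ₂ / (1 + ρ₂) → x ∉ c.core → G x = x := by
    intro x hx hxc
    have : ρ₂ / (1 + ρ₂) < 1 := by rw [div_lt_one (by positivity)]; linarith
    obtain ⟨y, hy, rfl⟩ := c.exists_j x (not_le.1 hxc) (hx.trans this)
    have h := hρ₂k y ((c.v_j_lt hy hρ₂.le).1 hx)
    simp only [hG]
    rw [c.lift_j _ hy, h.1, c.lift_j _ (hρ₁T y h.2).1, T.symm_apply_apply]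
  classical
  set F : E → X := fun y => if e y ∈ c.core then e y else G (e y) with hF
  have hFc : ∀ y, e y ∈ c.core → F y = e y := fun y hy => if_pos hy
  have hFn : ∀ y, e y ∉ c.core → F y = G (e y) := fun y hy => if_neg hy
  refine ⟨F, isOpenEmbedding_of_map_nhds ?_ ?_, ?_, ?_⟩
  · intro y₁ y₂ h
    by_cases h1 : e y₁ ∈ c.core <;> by_cases h2 : e y₂ ∈ c.core
    · rw [hFc _ h1, hFc _ h2] at h
      exact hee.injective h
    · rw [hFc _ h1, hFn _ h2] at h
      exact absurd (h ▸ h1) (hmain _ (heQ₀ _) h2).2.2.2.1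
    · rw [hFn _ h1, hFc _ h2] at h
      exact absurd (h ▸ h2) (hmain _ (heQ₀ _) h1).2.2.2.1
    · rw [hFn _ h1, hFn _ h2] at h
      apply hee.injective
      rw [← (hmain _ (heQ₀ _) h1).2.2.1, h, (hmain _ (heQ₀ _) h2).2.2.1]
  · intro y
    by_cases h1 : e y ∈ c.core
    · refine map_nhds_congr (hee.map_nhds_eq y) ?_
      have hlt : c.v (e y) < ρ₂ / (1 + ρ₂) := lt_of_le_of_lt h1 (by positivity)
      have : ∀ᶠ y' in 𝓝 y, c.v (e y') < ρ₂ / (1 + ρ₂) :=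
        ((c.continuous_v.comp hee.continuous).continuousAt).eventually_lt_const hlt
      filter_upwards [this] with y' hy'
      by_cases h2 : e y' ∈ c.core
      · exact hFc _ h2
      · rw [hFn _ h2, hGnear _ hy' h2]
    · refine map_nhds_congr (f := G ∘ e)
        (map_nhds_comp (hmain _ (heQ₀ _) h1).2.2.2.2.2 (hee.map_nhds_eq y)) ?_
      filter_upwards [(c.isClosed_core.isOpen_compl.preimage hee.continuous).mem_nhds h1]
        with y' hy' using hFn _ hy'
  · intro x hx
    obtain ⟨y, rfl⟩ := hcoree hx
    exact ⟨y, hFc y hx⟩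
  · rintro _ ⟨y, rfl⟩
    by_cases h1 : e y ∈ c.core
    · rw [hFc _ h1]; exact hcU h1
    · rw [hFn _ h1]; exact (hmain _ (heQ₀ _) h1).2.2.2.2.1

end PolarCollar

section Collapse

theorem Homeomorph.mem_of_eq_self_off {X : Type*} [TopologicalSpace X] (φ : X ≃ₜ X) {W : Set X}
    (h : ∀ x ∉ W, φ x = x) {x : X}
    (hx : x ∈ W) : φ x ∈ W := by
  by_contra hn
  exact hn ((φ.injective (h _ hn)).symm ▸ hx)

variable {E X : Type*} [NormedAddCommGroup E] [NormedSpace ℝ E] [ProperSpace E]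
  [MetricSpace X] [CompactSpace X]

/-- One step of the shrinking process. -/
theorem IsCellular.exists_homeomorph_shrink_step {A : Set X} (hA : IsCellular E A)
    (hc : IsCompact A) {U : Set X} (hU : IsOpen U) (hAU : A ⊆ U) {ε ε' : ℝ} (hε : 0 < ε)
    (hε' : 0 < ε') (Φ : X ≃ₜ X) (hΦ : ∀ x ∈ A, ∀ y ∈ A, dist (Φ x) (Φ y) < ε) :
    ∃ Φ' : X ≃ₜ X, (∀ x ∉ U, Φ' x = Φ x) ∧ (∀ x, dist (Φ x) (Φ' x) ≤ 3 * ε) ∧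
      ∀ x ∈ A, ∀ y ∈ A, dist (Φ' x) (Φ' y) < ε' := by
  set W : Set X := U ∩ ⋃ a ∈ A, Φ ⁻¹' ball (Φ a) ε with hW
  have hWo : IsOpen W := hU.inter (isOpen_biUnion fun a _ => isOpen_ball.preimage Φ.continuous)
  have hAW : A ⊆ W := fun x hx => ⟨hAU hx, mem_biUnion hx (mem_ball_self hε)⟩
  obtain ⟨δ, hδ, hu⟩ := Metric.uniformContinuous_iff.1
    (CompactSpace.uniformContinuous_of_continuous Φ.continuous) ε' hε'
  obtain ⟨φ, hφW, hφA⟩ := hA.exists_homeomorph_shrink hc hWo hAW hδ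
  have hd : ∀ x ∈ W, ∀ y ∈ W, dist (Φ x) (Φ y) < 3 * ε := by
    intro x hx y hy
    obtain ⟨a, ha, hxa⟩ := mem_iUnion₂.1 hx.2
    obtain ⟨b, hb, hyb⟩ := mem_iUnion₂.1 hy.2
    have h1 : dist (Φ x) (Φ a) < ε := hxa
    have h2 : dist (Φ y) (Φ b) < ε := hyb
    have h3 := hΦ a ha b hb
    have h4 := dist_triangle4 (Φ x) (Φ a) (Φ b) (Φ y)
    rw [dist_comm (Φ b)] at h4
    linarith
  refine ⟨φ.trans Φ, fun x hx => ?_, fun x => ?_, fun x hx y hy => hu (hφA x hx y hy)⟩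
  · simp [hφW x fun h => hx h.1]
  · by_cases hx : x ∈ W
    · exact (hd x hx _ (φ.mem_of_eq_self_off hφW hx)).le
    · simp [hφW x hx]; positivity

/-- A cellular compact set can be collapsed to a point by a surjection supported near it. -/
theorem IsCellular.exists_collapse {A : Set X} (hA : IsCellular E A) (hne : A.Nonempty)
    (hc : IsCompact A) {U : ℕ → Set X} (hU : ∀ n, IsOpen (U n)) (hAU : ∀ n, A ⊆ U n)
    (hUU : ∀ n, closure (U (n + 1)) ⊆ U n) (hUA : ∀ x ∉ A, ∃ n, x ∉ U n) :
    ∃ (Φ : X → X) (q : X), Continuous Φ ∧ Function.Surjective Φ ∧ (∀ x ∉ U 0, Φ x = x) ∧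
      (∀ x, Φ x = q ↔ x ∈ A) ∧ InjOn Φ Aᶜ := by
  set r : ℕ → ℝ := fun n => (1 / 2) ^ n with hr
  have hr0 : ∀ n, 0 < r n := fun n => by positivity
  set P : ℕ → (X ≃ₜ X) → Prop := fun n Φ => ∀ x ∈ A, ∀ y ∈ A, dist (Φ x) (Φ y) < r n with hP
  have hstep : ∀ n (Φ : {Φ // P n Φ}), ∃ Φ' : {Φ // P (n + 1) Φ},
      (∀ x ∉ U n, Φ'.1 x = Φ.1 x) ∧ ∀ x, dist (Φ.1 x) (Φ'.1 x) ≤ 3 * r n := by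
    intro n Φ
    obtain ⟨Φ', h1, h2, h3⟩ := hA.exists_homeomorph_shrink_step hc (hU n) (hAU n) (hr0 n)
      (hr0 (n + 1)) Φ.1 Φ.2
    exact ⟨⟨Φ', h3⟩, h1, h2⟩
  obtain ⟨Φ₀, hΦ₀U, hΦ₀⟩ := hA.exists_homeomorph_shrink hc (hU 0) (hAU 0) (hr0 0)
  choose g hgU hgd using hstep
  set S : (n : ℕ) → {Φ // P n Φ} := fun n => Nat.rec ⟨Φ₀, hΦ₀⟩ g n with hS
  set f : ℕ → X ≃ₜ X := fun n => (S n).1 with hf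
  have hfA : ∀ n, ∀ x ∈ A, ∀ y ∈ A, dist (f n x) (f n y) < r n := fun n => (S n).2
  have hfU : ∀ n, ∀ x ∉ U n, f (n + 1) x = f n x := fun n => hgU n (S n)
  have hfd : ∀ x n, dist (f n x) (f (n + 1) x) ≤ 3 * (1 / 2) ^ n := fun x n => hgd n (S n) x
  have hanti : Antitone U := antitone_nat_of_succ_le fun n => subset_closure.trans (hUU n)
  have hstable : ∀ n m, n ≤ m → ∀ x ∉ U n, f m x = f n x := by
    intro n m hnm x hx
    induction m, hnm using Nat.le_induction with
    | base => rfl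
    | succ m hm ih => rw [hfU m x fun h => hx (hanti hm h), ih]
  have hlim : ∀ x, ∃ y, Tendsto (fun n => f n x) atTop (𝓝 y) := fun x =>
    cauchySeq_tendsto_of_complete (cauchySeq_of_le_geometric (1 / 2) 3 (by norm_num) (hfd x))
  choose Φ hΦ using hlim
  have hdist : ∀ n x, dist (f n x) (Φ x) ≤ 6 * r n := fun n x => by
    have := dist_le_of_le_geometric_of_tendsto (1 / 2) 3 (by norm_num) (hfd x) (hΦ x) n
    calc _ ≤ _ := this
      _ = 6 * r n := by rw [hr]; ring
  have hrlim : Tendsto r atTop (𝓝 0) :=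
    tendsto_pow_atTop_nhds_zero_of_lt_one (by norm_num) (by norm_num)
  have hrlim6 : Tendsto (fun n => 6 * r n) atTop (𝓝 0) := by simpa using hrlim.const_mul 6
  have hunif : TendstoUniformly (fun n x => f n x) Φ atTop := by
    rw [Metric.tendstoUniformly_iff]
    intro ε hε
    filter_upwards [hrlim6.eventually_lt_const hε] with n hn x
    rw [dist_comm]
    exact (hdist n x).trans_lt hn
  have hΦc : Continuous Φ := hunif.continuous (.of_forall fun n => (f n).continuous)
  have hΦU : ∀ n, ∀ x ∉ U n, Φ x = f n x := fun n x hx =>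
    tendsto_nhds_unique (hΦ x) (tendsto_const_nhds.congr' (by
      filter_upwards [eventually_ge_atTop n] with m hm using (hstable n m hm x hx).symm))
  obtain ⟨a, ha⟩ := hne
  have hΦA : ∀ x ∈ A, Φ x = Φ a := by
    intro x hx
    have h1 : Tendsto (fun n => dist (f n x) (f n a)) atTop (𝓝 (dist (Φ x) (Φ a))) :=
      (hΦ x).dist (hΦ a)
    have h2 : Tendsto (fun n => dist (f n x) (f n a)) atTop (𝓝 0) :=
      squeeze_zero (fun _ => dist_nonneg) (fun n => (hfA n x hx a ha).le) hrlim
    exact dist_eq_zero.1 (tendsto_nhds_unique h1 h2)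
  have hΦnA : ∀ x ∉ A, Φ x ≠ Φ a := by
    intro x hx h
    obtain ⟨n, hn⟩ := hUA x hx
    have hcl : IsClosed (f (n + 1) '' closure (U (n + 1))) :=
      (isClosed_closure.isCompact.image (f (n + 1)).continuous).isClosed
    have hmem : Φ a ∈ f (n + 1) '' closure (U (n + 1)) := by
      refine hcl.mem_of_tendsto (hΦ a) ?_
      filter_upwards [eventually_ge_atTop (n + 1)] with m hm
      obtain ⟨w, hw⟩ := (f (n + 1)).surjective (f m a)
      refine ⟨w, by_contra fun hwn => ?_, hw⟩
      have hwU : w ∉ U (n + 1) := fun h => hwn (subset_closure h)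
      rw [← hstable _ _ hm w hwU] at hw
      exact hwU ((f m).injective hw ▸ hAU _ ha)
    obtain ⟨w, hw, hwa⟩ := hmem
    rw [← h, hΦU (n + 1) x fun h => hn (hUU n (subset_closure h))] at hwa
    exact hn (hUU n ((f (n + 1)).injective hwa ▸ hw))
  refine ⟨Φ, Φ a, hΦc, ?_, ?_, fun x => ⟨fun h => by_contra fun hx => hΦnA x hx h, hΦA x⟩, ?_⟩
  · intro y
    have hcl : IsClosed (range Φ) := (isCompact_range hΦc).isClosed
    refine hcl.closure_subset (Metric.mem_closure_iff.2 fun ε hε => ?_)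
    obtain ⟨n, hn⟩ := (hrlim6.eventually_lt_const hε).exists
    obtain ⟨x, rfl⟩ := (f n).surjective y
    exact ⟨Φ x, mem_range_self x, (hdist n x).trans_lt hn⟩
  · intro x hx
    rw [hΦU 0 x hx]
    exact hΦ₀U x hx
  · intro x hx y hy h
    obtain ⟨n, hn⟩ := hUA x hx
    obtain ⟨m, hm⟩ := hUA y hy
    have h1 : x ∉ U (max n m) := fun h => hn (hanti (le_max_left _ _) h)
    have h2 : y ∉ U (max n m) := fun h => hm (hanti (le_max_right _ _) h)
    rw [hΦU _ x h1, hΦU _ y h2] at h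
    exact (f _).injective h

end Collapse

namespace PolarCollar

variable {E X : Type*} [NormedAddCommGroup E] [InnerProductSpace ℝ E] [ProperSpace E] [Nontrivial E]
  [MetricSpace X] [CompactSpace X] (c : PolarCollar E X)

/-- The closed region inside the unit sphere of a polar collar is parametrised by a ball. -/
theorem exists_parametrization (hX : HasPuncturedCells E X) :
    ∃ ψ : E → X, Continuous (fun y : closedBall (0 : E) 1 => ψ y) ∧ InjOn ψ (closedBall 0 1) ∧
      ψ '' closedBall 0 1 = {x | c.v x ≤ 1 / 2} ∧ ψ '' ball 0 1 = {x | c.v x < 1 / 2} := by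
  set U : ℕ → Set X := fun n => {x | c.v x < 1 / (n + 3)} with hU
  have hpos : ∀ n : ℕ, (0 : ℝ) < 1 / (n + 3) := fun n => by positivity
  obtain ⟨Φ, q, hΦc, hΦs, hΦU, hΦq, hΦi⟩ := (c.isCellular_core hX).exists_collapse c.core_nonempty
    c.isClosed_core.isCompact (U := U) (fun n => isOpen_lt c.continuous_v continuous_const)
    (fun n x hx => lt_of_le_of_lt hx (hpos n))
    (fun n => by
      refine (closure_lt_subset_le c.continuous_v continuous_const).trans fun x hx => ?_
      refine lt_of_le_of_lt (show c.v x ≤ _ from hx) ?_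
      push_cast
      exact one_div_lt_one_div_of_lt (by positivity) (by linarith))
    (fun x hx => by
      obtain ⟨n, hn⟩ := exists_nat_one_div_lt (show 0 < c.v x from not_le.1 hx)
      refine ⟨n, fun h => ?_⟩
      have h1 : (1 : ℝ) / (n + 3) < 1 / (n + 1) :=
        one_div_lt_one_div_of_lt (by positivity) (by linarith)
      have h2 : c.v x < 1 / (n + 3) := h
      linarith)
  have hU0 : ∀ x, 1 / 2 ≤ c.v x → Φ x = x := fun x hx => hΦU x fun h => by
    have h : c.v x < 1 / ((0 : ℕ) + 3) := h
    norm_num at h hx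
    linarith
  have hid : ∀ x, 1 / 2 ≤ c.v (Φ x) → Φ x = x := by
    intro x hx
    have h1 := hU0 _ hx
    have hn : Φ x ∉ c.core := fun h => by
      have : c.v (Φ x) ≤ 0 := h
      linarith
    have hxn : x ∉ c.core := fun h => by
      rw [(hΦq x).2 h] at h1
      have := (hΦq q).1 h1
      rw [(hΦq x).2 h] at hn
      exact hn this
    exact hΦi hn hxn h1
  classical
  set ψ : E → X := fun y => if y = 0 then q else Φ (c.j y) with hψ
  have hψ0 : ψ 0 = q := if_pos rfl
  have hψn : ∀ y ≠ 0, ψ y = Φ (c.j y) := fun y hy => if_neg hy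
  have himage : ∀ (s : Set E) (p : X → Prop), (0 : E) ∈ s → (∀ x, c.v x ≤ 0 → p x) →
      (∀ y ≠ 0, p (c.j y) ↔ y ∈ s) → (∀ x, p x → c.v x ≤ 1 / 2) → (∀ x, c.v x < 1 / 2 → p x) →
      ψ '' s = {x | p x} := by
    intro s p h0 hcore hj hle hlt
    have key : ∀ x, p (Φ x) ↔ p x := by
      intro x
      by_cases h : 1 / 2 ≤ c.v x
      · rw [hU0 x h]
      by_cases h' : 1 / 2 ≤ c.v (Φ x)
      · rw [hid x h']
      · exact iff_of_true (hlt _ (not_le.1 h')) (hlt _ (not_le.1 h))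
    obtain ⟨a, ha⟩ := c.core_nonempty
    ext w
    constructor
    · rintro ⟨y, hy, rfl⟩
      rcases eq_or_ne y 0 with rfl | hy0
      · rw [hψ0, ← (hΦq a).2 ha]
        exact (key a).2 (hcore a ha)
      · rw [hψn y hy0]
        exact (key _).2 ((hj y hy0).2 hy)
    · intro hw
      obtain ⟨x, rfl⟩ := hΦs w
      have hx : p x := (key x).1 hw
      by_cases hxc : x ∈ c.core
      · exact ⟨0, h0, by rw [hψ0, (hΦq x).2 hxc]⟩
      · obtain ⟨y, hy, rfl⟩ := c.exists_j x (not_le.1 hxc) ((hle x hx).trans_lt (by norm_num))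
        exact ⟨y, (hj y hy).1 hx, hψn y hy⟩
  refine ⟨ψ, ?_, ?_, ?_, ?_⟩
  · suffices Continuous ψ from this.comp continuous_subtype_val
    rw [continuous_iff_continuousAt]
    intro y
    rcases eq_or_ne y 0 with rfl | hy
    · rw [ContinuousAt, hψ0]
      intro V hV
      obtain ⟨V', hV', hVo, hqV⟩ := _root_.mem_nhds_iff.1 hV
      obtain ⟨r, hr, h⟩ := c.exists_subset_of_core_subset (hVo.preimage hΦc) fun x hx => by
        rw [mem_preimage, (hΦq x).2 hx]; exact hqV
      rw [mem_map]
      filter_upwards [ball_mem_nhds (0 : E) hr] with y hy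
      rcases eq_or_ne y 0 with rfl | hy0
      · rw [mem_preimage, hψ0]; exact hV' hqV
      · rw [mem_preimage, hψn y hy0]
        exact hV' (h _ ((c.v_j_lt hy0 hr.le).2 (by simpa using hy)))
    · have : ContinuousAt (Φ ∘ c.j) y := hΦc.continuousAt.comp (c.map_nhds y hy).le
      refine this.congr ?_
      filter_upwards [isOpen_ne.mem_nhds hy] with w hw using (hψn w hw).symm
  · intro y₁ _ y₂ _ h
    rcases eq_or_ne y₁ 0 with rfl | h1 <;> rcases eq_or_ne y₂ 0 with rfl | h2
    · rfl
    · rw [hψ0, hψn _ h2] at h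
      exact absurd ((hΦq _).1 h.symm) (c.j_notMem_core h2)
    · rw [hψ0, hψn _ h1] at h
      exact absurd ((hΦq _).1 h) (c.j_notMem_core h1)
    · rw [hψn _ h1, hψn _ h2] at h
      exact c.injOn h1 h2 (hΦi (c.j_notMem_core h1) (c.j_notMem_core h2) h)
  · exact himage _ _ (by simp) (fun x h => h.trans (by norm_num))
      (fun y hy => by rw [c.v_le_half_iff hy]; simp) (fun x h => h) (fun x h => h.le)
  · exact himage _ _ (by simp) (fun x h => lt_of_le_of_lt h (by norm_num))
      (fun y hy => by rw [c.v_lt_half_iff hy]; simp) (fun x h => le_of_lt h) (fun x h => h)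

/-- The closure of the component inside the unit sphere of a polar collar is a ball. -/
theorem nonempty_homeomorph_closedBall (hX : HasPuncturedCells E X) {x : X}
    (hx : c.v x < 1 / 2) :
    Nonempty ((closure (connectedComponentIn {x | c.v x = 1 / 2}ᶜ x) : Set X) ≃ₜ
      closedBall (0 : E) 1) := by
  obtain ⟨ψ, hψc, hψi, hψC, hψB⟩ := c.exists_parametrization hX
  have hψon : ContinuousOn ψ (closedBall 0 1) := continuousOn_iff_continuous_domRestrict.2 hψc
  have hconn : IsPreconnected {x | c.v x < 1 / 2} := by
    rw [← hψB]
    exact (convex_ball (0 : E) 1).isPreconnected.image ψ (hψon.mono ball_subset_closedBall)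
  have hcomp : connectedComponentIn {x | c.v x = 1 / 2}ᶜ x = {x | c.v x < 1 / 2} := by
    refine Subset.antisymm ?_ (hconn.subset_connectedComponentIn hx fun y hy => ne_of_lt hy)
    have hsub := connectedComponentIn_subset {x | c.v x = 1 / 2}ᶜ x
    have hxm : x ∈ ({x | c.v x = 1 / 2}ᶜ : Set X) := ne_of_lt hx
    refine isPreconnected_connectedComponentIn.subset_left_of_subset_union
      (u := {x | c.v x < 1 / 2}) (v := {x | 1 / 2 < c.v x})
      (isOpen_lt c.continuous_v continuous_const) (isOpen_lt continuous_const c.continuous_v)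
      ?_ (fun y hy => lt_or_gt_of_ne (hsub hy)) ⟨x, mem_connectedComponentIn hxm, hx⟩
    exact Set.disjoint_left.2 fun y (h1 : c.v y < 1 / 2) (h2 : 1 / 2 < c.v y) => h1.not_gt h2
  have hcl : closure {x | c.v x < 1 / 2} = {x | c.v x ≤ 1 / 2} := by
    refine Subset.antisymm (closure_lt_subset_le c.continuous_v continuous_const) ?_
    rw [← hψC, ← hψB, ← closure_ball (0 : E) one_ne_zero]
    exact ContinuousOn.image_closure (by rwa [closure_ball (0 : E) one_ne_zero])
  rw [hcomp, hcl, ← hψC]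
  have : CompactSpace (closedBall (0 : E) 1) :=
    isCompact_iff_compactSpace.1 (isCompact_closedBall 0 1)
  have hco : Continuous (hψi.bijOn_image.equiv ψ) := hψc.subtype_mk _
  exact ⟨(Continuous.homeoOfEquivCompactToT2 hco).symm⟩

end PolarCollar

theorem UnitAddCircle.exists_eq_add_intCast {a b : ℝ} (h : (a : UnitAddCircle) = b) :
    ∃ m : ℤ, a = b + m := by
  obtain ⟨m, hm⟩ := AddCircle.coe_eq_zero_iff (1 : ℝ) |>.1
    (show ((a - b : ℝ) : UnitAddCircle) = 0 by rw [AddCircle.coe_sub, h, sub_self])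
  exact ⟨m, by rw [zsmul_one] at hm; linarith⟩

theorem IsPreconnected.exists_eq_add_intCast {α : Type*} [TopologicalSpace α] {s : Set α}
    (hs : IsPreconnected s) {f g : α → ℝ} (hf : ContinuousOn f s) (hg : ContinuousOn g s)
    (h : ∀ x ∈ s, (f x : UnitAddCircle) = g x) : ∃ m : ℤ, ∀ x ∈ s, f x = g x + m := by
  obtain ⟨_, ⟨m, rfl⟩, hm⟩ := hs.eqOn_const_of_mapsTo (T := range ((↑) : ℤ → ℝ))
    Int.isClosedEmbedding_coe_real.isInducing.isDiscrete_range (hf.sub hg)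
    (fun x hx => by
      obtain ⟨m, hm⟩ := UnitAddCircle.exists_eq_add_intCast (h x hx)
      exact ⟨m, by simp [hm]⟩)
    ⟨_, 0, rfl⟩
  refine ⟨m, fun x hx => ?_⟩
  have : f x - g x = m := hm hx
  linarith

section Lift

variable {E X : Type*} [NormedAddCommGroup E] [NormedSpace ℝ E] [TopologicalSpace X]

theorem exists_lift_unitAddCircle (θ : C(E, UnitAddCircle)) :
    ∃ l : C(E, ℝ), ∀ y, (l y : UnitAddCircle) = θ y := by
  obtain ⟨a, ha⟩ := QuotientAddGroup.mk_surjective (θ 0)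
  obtain ⟨l, ⟨-, hl⟩, -⟩ := (AddCircle.isCoveringMap_coe (1 : ℝ)).existsUnique_continuousMap_lifts
    θ 0 a ha
  exact ⟨l, congrFun hl⟩

/-- A circle-valued function on a space covered by two cells as the sphere is lifts to the line. -/
theorem HasPuncturedCells.exists_lift_unitAddCircle [T1Space X] (hX : HasPuncturedCells E X)
    (hE : 1 < Module.rank ℝ E) {z p : X} (hzp : z ≠ p) {θ : X → UnitAddCircle}
    (hθ : Continuous θ) : ∃ l : X → ℝ, Continuous l ∧ ∀ x, (l x : UnitAddCircle) = θ x := by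
  classical
  obtain ⟨e₁, he₁, hr₁, -⟩ := hX z p hzp
  obtain ⟨e₂, he₂, -, h₂⟩ := hX p z hzp.symm
  obtain ⟨l₁, hl₁⟩ := _root_.exists_lift_unitAddCircle ⟨θ ∘ e₁, hθ.comp he₁.continuous⟩
  obtain ⟨l₂, hl₂⟩ := _root_.exists_lift_unitAddCircle ⟨θ ∘ e₂, hθ.comp he₂.continuous⟩
  set l : X → ℝ := l₁ ∘ Function.invFun e₁ with hl
  have hle (y : E) : l (e₁ y) = l₁ y := by
    simp [hl, Function.leftInverse_invFun he₁.injective y]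
  have hne {x : X} (hx : x ≠ z) : ∃ y, e₁ y = x := by
    rwa [← mem_range, hr₁, mem_compl_singleton_iff]
  have hlc {x : X} (hx : x ≠ z) : ContinuousAt l x := by
    obtain ⟨y, rfl⟩ := hne hx
    rw [← he₁.continuousAt_iff]
    exact (l₁.continuous.congr fun y => (hle y).symm).continuousAt
  have hlθ {x : X} (hx : x ≠ z) : (l x : UnitAddCircle) = θ x := by
    obtain ⟨y, rfl⟩ := hne hx
    simpa [hle] using hl₁ y
  have he₂z {y : E} (hy : y ∈ ({0}ᶜ : Set E)) : e₂ y ≠ z := fun h =>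
    hy (he₂.injective (h.trans h₂.symm))
  obtain ⟨m, hm⟩ := (isConnected_compl_singleton_of_one_lt_rank hE (0 : E)).isPreconnected
    |>.exists_eq_add_intCast (f := l ∘ e₂) (g := l₂)
    (fun y hy => ((hlc (he₂z hy)).comp he₂.continuous.continuousAt).continuousWithinAt)
    l₂.continuous.continuousOn (fun y hy => by
      rw [Function.comp, hlθ (he₂z hy)]; exact (hl₂ y).symm)
  have hm₂ (y : E) : Function.update l z (l₂ 0 + m) (e₂ y) = l₂ y + m := by
    by_cases hy : y = 0
    · rw [hy, h₂, Function.update_self]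
    · rw [Function.update_of_ne (he₂z hy)]; exact hm y hy
  refine ⟨Function.update l z (l₂ 0 + m), continuous_iff_continuousAt.2 fun x => ?_, fun x => ?_⟩
  · by_cases hx : x = z
    · rw [hx, ← h₂, ← he₂.continuousAt_iff, h₂]
      exact ((l₂.continuous.add continuous_const).congr fun y => (hm₂ y).symm).continuousAt
    · exact (continuousAt_update_of_ne hx).2 (hlc hx)
  · by_cases hx : x = z
    · have hz : (l₂ 0 : UnitAddCircle) = θ z := by simpa [h₂] using hl₂ 0
      have hm0 : ((m : ℝ) : UnitAddCircle) = 0 :=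
        (AddCircle.coe_eq_zero_iff 1).2 ⟨m, by simp⟩
      rw [hx, Function.update_self, AddCircle.coe_add, hz, hm0, add_zero]
    · rw [Function.update_of_ne hx, hlθ hx]

end Lift

section Height

variable {E S X : Type*} [NormedAddCommGroup E] [NormedSpace ℝ E]
  [TopologicalSpace S] [CompactSpace S] [PreconnectedSpace S] [Nonempty S]
  [TopologicalSpace X] [T2Space X]

/-- A two-sided collar in a space like the sphere admits a height function, which is locally
constant outside the collar. -/
theorem HasPuncturedCells.exists_height (hX : HasPuncturedCells E X)
    (hE : 1 < Module.rank ℝ E) {γ : S × ℝ → X} (hinj : InjOn γ {q | |q.2| < 2})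
    (hmap : ∀ q : S × ℝ, |q.2| < 2 → map γ (𝓝 q) = 𝓝 (γ q)) :
    ∃ v : X → ℝ, Continuous v ∧ (∀ q : S × ℝ, |q.2| < 1 → v (γ q) = (q.2 + 1) / 2) ∧
      ∀ x, 0 < v x → v x < 1 → ∃ q : S × ℝ, |q.2| < 1 ∧ γ q = x := by
  classical
  set A : Set (S × ℝ) := {q | |q.2| < 2} with hA
  set K : Set (S × ℝ) := {q | |q.2| ≤ 1} with hK
  have hKA : K ⊆ A := fun q (hq : |q.2| ≤ 1) => show |q.2| < 2 by linarith
  have hAo : IsOpen A := isOpen_lt (by fun_prop) continuous_const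
  have hKc : IsClosed (γ '' K) := by
    have : K = univ ×ˢ Icc (-1 : ℝ) 1 := by ext q; simp [hK, abs_le]
    refine IsCompact.isClosed ((this ▸ isCompact_univ.prod isCompact_Icc).image_of_continuousOn ?_)
    exact fun q hq => ContinuousAt.continuousWithinAt (hmap q (hKA hq)).le
  set φ : ℝ → ℝ := fun t => max 0 (min 1 ((t + 1) / 2)) with hφ
  have hφc : Continuous φ := by fun_prop
  have hφ1 {t : ℝ} (ht : |t| < 1) : φ t = (t + 1) / 2 := by
    rw [abs_lt] at ht
    simp only [hφ]
    rw [min_eq_right (by linarith), max_eq_right (by linarith)]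
  have hφ0 {t : ℝ} (ht : ¬ |t| < 1) : (φ t : UnitAddCircle) = 0 := by
    rcases le_abs.1 (not_lt.1 ht) with h | h
    · have : φ t = 1 := by
        simp only [hφ]
        rw [min_eq_left (by linarith), max_eq_right (by linarith)]
      rw [this]; exact AddCircle.coe_period 1
    · have : φ t = 0 := by
        simp only [hφ]
        rw [min_eq_right (by linarith), max_eq_left (by linarith)]
      rw [this]; simp
  set θ : X → UnitAddCircle :=
    fun x => if x ∈ γ '' A then (φ (Function.invFunOn γ A x).2 : UnitAddCircle) else 0 with hθ
  have hθγ {q : S × ℝ} (hq : q ∈ A) : θ (γ q) = φ q.2 := by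
    simp only [hθ]
    rw [if_pos (mem_image_of_mem _ hq), hinj.leftInvOn_invFunOn hq]
  have hθ0 {x : X} (hx : ¬ ∃ q : S × ℝ, |q.2| < 1 ∧ γ q = x) : θ x = 0 := by
    by_cases hxA : x ∈ γ '' A
    · obtain ⟨q, hq, rfl⟩ := hxA
      rw [hθγ hq, hφ0 fun h => hx ⟨q, h, rfl⟩]
    · exact if_neg hxA
  have hθc : Continuous θ := by
    refine continuous_iff_continuousAt.2 fun x => ?_
    by_cases hx : x ∈ γ '' K
    · obtain ⟨q, hq, rfl⟩ := hx
      rw [ContinuousAt, ← hmap q (hKA hq), tendsto_map'_iff, hθγ (hKA hq)]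
      have : Tendsto (fun q : S × ℝ => (φ q.2 : UnitAddCircle)) (𝓝 q) (𝓝 (φ q.2)) :=
        ((AddCircle.continuous_mk' 1).comp (hφc.comp continuous_snd)).continuousAt
      refine this.congr' ?_
      filter_upwards [hAo.mem_nhds (hKA hq)] with w hw using (hθγ hw).symm
    · refine (continuousAt_const (y := (0 : UnitAddCircle))).congr ?_
      filter_upwards [hKc.isOpen_compl.mem_nhds hx] with w hw
      refine (hθ0 ?_).symm
      rintro ⟨q, hq, rfl⟩
      exact hw (mem_image_of_mem _ (show |q.2| ≤ 1 from hq.le))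
  obtain ⟨s₀⟩ := ‹Nonempty S›
  have hzp : γ (s₀, 0) ≠ γ (s₀, 1) := fun h => by
    have := hinj (show |(0 : ℝ)| < 2 by simp) (show |(1 : ℝ)| < 2 by simp) h
    simp at this
  obtain ⟨l, hlc, hl⟩ := hX.exists_lift_unitAddCircle hE hzp hθc
  have hApre : IsPreconnected A := by
    have : A = univ ×ˢ Ioo (-2 : ℝ) 2 := by ext q; simp [hA, abs_lt]
    exact this ▸ isPreconnected_univ.prod isPreconnected_Ioo
  obtain ⟨m, hm⟩ := hApre.exists_eq_add_intCast (f := l ∘ γ) (g := φ ∘ Prod.snd)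
    (fun q hq => (hlc.continuousAt.comp
      (show ContinuousAt γ q from (hmap q hq).le)).continuousWithinAt)
    (hφc.comp continuous_snd).continuousOn fun q hq => (hl _).trans (hθγ hq)
  refine ⟨fun x => l x - m, hlc.sub continuous_const, fun q hq => ?_, fun x h0 h1 => ?_⟩
  · have := hm q (show |q.2| < 2 by linarith)
    simp only [Function.comp, hφ1 hq] at this
    simp [this]
  · by_contra hx
    obtain ⟨k, hk⟩ := UnitAddCircle.exists_eq_add_intCast
      (show (l x : UnitAddCircle) = ((0 : ℝ) : UnitAddCircle) by rw [hl, hθ0 hx]; simp)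
    simp only [hk] at h0 h1
    have h0' : (m : ℝ) < k := by linarith
    have h1' : (k : ℝ) < m + 1 := by linarith
    norm_cast at h0' h1'
    omega

end Height

section Polar

theorem isOpenEmbedding_sub_one_div_add_one :
    IsOpenEmbedding (fun r : Ioi (0 : ℝ) => ((r : ℝ) - 1) / (r + 1)) := by
  refine isOpenEmbedding_of_map_nhds (fun r s h => ?_) fun r => ?_
  · have hr := mem_Ioi.1 r.2
    have hs := mem_Ioi.1 s.2
    rw [div_eq_div_iff (by positivity) (by positivity)] at h
    exact Subtype.ext (by linarith)
  · have hr : (0 : ℝ) < r := r.2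
    have h1 : (r : ℝ) + 1 ≠ 0 := by positivity
    have hd : HasStrictDerivAt (fun t : ℝ => (t - 1) / (t + 1)) (2 / ((r : ℝ) + 1) ^ 2) r := by
      have hd₁ : HasStrictDerivAt (fun t : ℝ => t - 1) 1 r :=
        (hasStrictDerivAt_id (r : ℝ)).sub_const 1
      have hd₂ : HasStrictDerivAt (fun t : ℝ => t + 1) 1 r :=
        (hasStrictDerivAt_id (r : ℝ)).add_const 1
      have h2 : 2 / ((r : ℝ) + 1) ^ 2 =
          (1 * ((r : ℝ) + 1) - ((r : ℝ) - 1) * 1) / ((r : ℝ) + 1) ^ 2 := by ring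
      exact h2 ▸ hd₁.fun_div hd₂ h1
    have := hd.map_nhds_eq (by positivity)
    rw [← isOpen_Ioi.isOpenEmbedding_subtypeVal.map_nhds_eq, Filter.map_map] at this
    exact this

variable (E : Type*) [NormedAddCommGroup E] [NormedSpace ℝ E] [Nontrivial E]

theorem exists_polar_map : ∃ ρ : E → sphere (0 : E) 1 × ℝ, InjOn ρ {0}ᶜ ∧
    (∀ y ≠ 0, map ρ (𝓝 y) = 𝓝 (ρ y)) ∧ (∀ y ≠ 0, (ρ y).2 = (‖y‖ - 1) / (‖y‖ + 1)) ∧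
    ∀ q : sphere (0 : E) 1 × ℝ, |q.2| < 1 → ∃ y ≠ 0, ρ y = q := by
  obtain ⟨s₀, hs₀⟩ := NormedSpace.sphere_nonempty (x := (0 : E)).2 zero_le_one
  have hval : IsOpenEmbedding ((↑) : ({0}ᶜ : Set E) → E) :=
    isOpen_compl_singleton.isOpenEmbedding_subtypeVal
  set D : ({0}ᶜ : Set E) → sphere (0 : E) 1 × ℝ :=
    Prod.map id (fun r : Ioi (0 : ℝ) => ((r : ℝ) - 1) / (r + 1)) ∘
      homeomorphUnitSphereProd E with hD
  have hDo : IsOpenEmbedding D :=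
    (IsOpenEmbedding.id.prodMap isOpenEmbedding_sub_one_div_add_one).comp
      (homeomorphUnitSphereProd E).isOpenEmbedding
  set ρ := Function.extend ((↑) : ({0}ᶜ : Set E) → E) D fun _ => (⟨s₀, hs₀⟩, 0) with hρ
  have hρD (y : ({0}ᶜ : Set E)) : ρ y = D y := hval.injective.extend_apply _ _ _
  refine ⟨ρ, fun y hy w hw h => ?_, fun y hy => ?_, fun y hy => ?_, fun q hq => ?_⟩
  · lift y to ({0}ᶜ : Set E) using hy
    lift w to ({0}ᶜ : Set E) using hw
    rw [hρD, hρD] at h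
    rw [hDo.injective h]
  · lift y to ({0}ᶜ : Set E) using hy
    rw [← hval.map_nhds_eq, Filter.map_map, hρD, ← hDo.map_nhds_eq]
    exact congrArg (map · _) (funext hρD)
  · lift y to ({0}ᶜ : Set E) using hy
    rw [hρD]
    simp [hD]
  · obtain ⟨h1, h2⟩ := abs_lt.1 hq
    have hpos : 0 < (1 + q.2) / (1 - q.2) := div_pos (by linarith) (by linarith)
    set y := (homeomorphUnitSphereProd E).symm (q.1, ⟨_, hpos⟩) with hy
    refine ⟨y, y.2, ?_⟩
    rw [hρD]
    have h3 : 1 - q.2 ≠ 0 := by linarith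
    refine Prod.ext ?_ ?_
    · simp [hD, hy]
    · simp only [hD, hy, Function.comp, Homeomorph.apply_symm_apply, Prod.map_snd]
      field_simp
      ring

variable {E} {X : Type*} [TopologicalSpace X]

/-- The polar collar given by a two-sided collar of the image of a sphere, and a height function. -/
theorem PolarCollar.exists_v_eq {γ : sphere (0 : E) 1 × ℝ → X} (hinj : InjOn γ {q | |q.2| < 1})
    (hmap : ∀ q : sphere (0 : E) 1 × ℝ, |q.2| < 1 → map γ (𝓝 q) = 𝓝 (γ q)) {v : X → ℝ}
    (hv : Continuous v) (hvγ : ∀ q : sphere (0 : E) 1 × ℝ, |q.2| < 1 → v (γ q) = (q.2 + 1) / 2)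
    (hγ : ∀ x, 0 < v x → v x < 1 → ∃ q : sphere (0 : E) 1 × ℝ, |q.2| < 1 ∧ γ q = x) :
    ∃ c : PolarCollar E X, c.v = v := by
  obtain ⟨ρ, hρi, hρm, hρn, hρs⟩ := exists_polar_map E
  have hρ1 {y : E} (hy : y ≠ 0) : |(ρ y).2| < 1 := by
    have := norm_pos_iff.2 hy
    rw [hρn y hy, abs_lt, lt_div_iff₀ (by positivity), div_lt_iff₀ (by positivity)]
    constructor <;> linarith
  refine ⟨⟨γ ∘ ρ, v, hinj.comp hρi fun y hy => hρ1 hy,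
    fun y hy => map_nhds_comp (hmap _ (hρ1 hy)) (hρm y hy), hv, fun y hy => ?_,
    fun x h0 h1 => ?_⟩, rfl⟩
  · have : ‖y‖ + 1 ≠ 0 := by positivity
    rw [Function.comp, hvγ _ (hρ1 hy), hρn y hy]
    field_simp
    ring
  · obtain ⟨q, hq, rfl⟩ := hγ x h0 h1
    obtain ⟨y, hy, rfl⟩ := hρs q hq
    exact ⟨y, hy, rfl⟩

end Polar

/-- The topological Schoenflies theorem for a bicollared sphere, in a space like the sphere. -/
theorem HasPuncturedCells.nonempty_homeomorph_closedBall {E X : Type*} [NormedAddCommGroup E]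
    [InnerProductSpace ℝ E] [ProperSpace E] [MetricSpace X] [CompactSpace X]
    (hX : HasPuncturedCells E X) (hE : 1 < Module.rank ℝ E) {γ : sphere (0 : E) 1 × ℝ → X}
    (hinj : InjOn γ {q | |q.2| < 2})
    (hmap : ∀ q : sphere (0 : E) 1 × ℝ, |q.2| < 2 → map γ (𝓝 q) = 𝓝 (γ q)) {x : X}
    (hx : x ∉ range fun s => γ (s, 0)) :
    Nonempty ((closure (connectedComponentIn (range fun s => γ (s, 0))ᶜ x) : Set X) ≃ₜ
      closedBall (0 : E) 1) := by
  have : Nontrivial E := rank_pos_iff_nontrivial.1 (zero_lt_one.trans hE)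
  have : PreconnectedSpace (sphere (0 : E) 1) :=
    isPreconnected_iff_preconnectedSpace.1 (isPreconnected_sphere hE 0 1)
  have : Nonempty (sphere (0 : E) 1) := (NormedSpace.sphere_nonempty.2 zero_le_one).to_subtype
  obtain ⟨v, hv, hvγ, hγ⟩ := hX.exists_height hE hinj hmap
  have hle {q : sphere (0 : E) 1 × ℝ} (hq : |q.2| < 1) : |q.2| < 2 := hq.trans one_lt_two
  have hrange : (range fun s => γ (s, 0)) = {x | v x = 1 / 2} := by
    ext x
    constructor
    · rintro ⟨s, rfl⟩
      simp [hvγ (s, 0) (by simp)]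
    · intro (h : v x = 1 / 2)
      obtain ⟨⟨s, t⟩, hq, rfl⟩ := hγ x (by rw [h]; norm_num) (by rw [h]; norm_num)
      rw [hvγ _ hq] at h
      exact ⟨s, by rw [show t = 0 by simp only at h; linarith]⟩
  rw [hrange] at hx ⊢
  rcases lt_or_gt_of_ne (show v x ≠ 1 / 2 from hx) with h | h
  · obtain ⟨c, rfl⟩ := PolarCollar.exists_v_eq (hinj.mono fun q hq => hle hq)
      (fun q hq => hmap q (hle hq)) hv hvγ hγ
    exact c.nonempty_homeomorph_closedBall hX h
  · set N := (Homeomorph.refl (sphere (0 : E) 1)).prodCongr (Homeomorph.neg ℝ) with hN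
    have hN2 (q) : |(N q).2| = |q.2| := by simp [hN]
    obtain ⟨c, hc⟩ := PolarCollar.exists_v_eq (γ := γ ∘ N) (v := fun x => 1 - v x)
      (hinj.comp N.injective.injOn fun q (hq : |q.2| < 1) =>
        show |(N q).2| < 2 by rw [hN2]; exact hle hq)
      (fun q hq => map_nhds_comp (hmap _ (by rw [hN2]; exact hle hq)) (N.map_nhds_eq q))
      (continuous_const.sub hv) (fun q hq => by
        rw [Function.comp, hvγ _ (by rwa [hN2])]; simp [hN]; ring)
      (fun x h0 h1 => by
        obtain ⟨q, hq, rfl⟩ := hγ x (by linarith) (by linarith)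
        exact ⟨N.symm q, by rwa [← hN2, N.apply_symm_apply], by simp⟩)
    have hc' (x) : c.v x = 1 - v x := congrFun hc x
    have hset : {x | v x = 1 / 2} = {x | c.v x = 1 / 2} := by
      ext x
      simp only [mem_ofPred_eq, hc']
      constructor <;> intro h <;> linarith
    rw [hset]
    exact c.nonempty_homeomorph_closedBall hX (by rw [hc']; linarith)

theorem hasPuncturedCells_sphere {F : Type*} [NormedAddCommGroup F] [InnerProductSpace ℝ F] (n : ℕ)
    [Fact (finrank ℝ F = n + 1)] :
    HasPuncturedCells (EuclideanSpace ℝ (Fin n)) (sphere (0 : F) 1) := by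
  intro z p hzp
  set s := (stereographic' n z).symm with hs
  have hsrc : s.source = univ := stereographic'_target z
  have hp : p ∈ (stereographic' n z).source := by simpa using hzp.symm
  refine ⟨s ∘ Homeomorph.addRight (stereographic' n z p),
    (s.isOpenEmbedding hsrc).comp (Homeomorph.isOpenEmbedding _), ?_, ?_⟩
  · rw [(Homeomorph.surjective _).range_comp, ← image_univ, ← hsrc, s.image_source_eq_target,
      hs, OpenPartialHomeomorph.symm_target, stereographic'_source]
  · simpa using (stereographic' n z).left_inv hp

/-- A map of `S × ℝ` which is locally an open embedding along `S × {0}`, and injective on it,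
restricts to a collar. -/
theorem exists_collar {S X : Type*} [TopologicalSpace S] [CompactSpace S] [TopologicalSpace X]
    [T2Space X] {h : S × ℝ → X} (hinj : Function.Injective fun s => h (s, 0))
    (hmap : ∀ s, ∀ᶠ q in 𝓝 (s, (0 : ℝ)), map h (𝓝 q) = 𝓝 (h q))
    (hloc : ∀ s, ∃ u ∈ 𝓝 (s, (0 : ℝ)), InjOn h u) :
    ∃ γ : S × ℝ → X, InjOn γ {q | |q.2| < 2} ∧
      (∀ q : S × ℝ, |q.2| < 2 → map γ (𝓝 q) = 𝓝 (γ q)) ∧ ∀ s, γ (s, 0) = h (s, 0) := by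
  set Z : Set (S × ℝ) := univ ×ˢ {0} with hZ
  have hZc : IsCompact Z := isCompact_univ.prod isCompact_singleton
  have hmem {q : S × ℝ} (hq : q ∈ Z) : q = (q.1, 0) := Prod.ext rfl hq.2
  obtain ⟨t, ht, hti⟩ := InjOn.exists_mem_nhdsSet (f := h) (s := Z)
    (fun q hq w hw e => by
      rw [hmem hq, hmem hw] at e ⊢
      rw [hinj e])
    hZc
    (fun q hq => by rw [hmem hq]; exact (hmap q.1).self_of_nhds.le)
    (fun q hq => by rw [hmem hq]; exact hloc q.1)
  have hm : {q | map h (𝓝 q) = 𝓝 (h q)} ∈ 𝓝ˢ Z :=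
    mem_nhdsSet_iff_forall.2 fun q hq => by rw [hmem hq]; exact hmap q.1
  have hboth := inter_mem ht hm
  rw [hZ, isCompact_univ.nhdsSet_prod_eq isCompact_singleton, nhdsSet_univ, nhdsSet_singleton,
    mem_prod_iff] at hboth
  obtain ⟨u, hu, w, hw, huw⟩ := hboth
  obtain ⟨ε, hε, hεw⟩ := Metric.mem_nhds_iff.1 hw
  set D := (Homeomorph.refl S).prodCongr (Homeomorph.mulRight₀ (ε / 2) (by positivity)) with hD
  have hDm {q : S × ℝ} (hq : |q.2| < 2) : D q ∈ t ∩ {q | map h (𝓝 q) = 𝓝 (h q)} := by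
    refine huw ⟨mem_top.1 hu ▸ mem_univ _, hεw ?_⟩
    have : |q.2| * (ε / 2) < ε := by nlinarith
    simpa [hD, abs_mul, abs_of_pos hε] using this
  exact ⟨h ∘ D, hti.comp D.injective.injOn fun q hq => (hDm hq).1,
    fun q hq => map_nhds_comp (hDm hq).2 (D.map_nhds_eq q), fun s => by simp [hD]⟩

section SphereProj

variable (E : Type*) [NormedAddCommGroup E] [NormedSpace ℝ E] [Nontrivial E]

/-- The radial projection to the unit sphere, with a junk value at `0`. -/
def sphereProj : E → sphere (0 : E) 1 :=
  Function.extend ((↑) : ({0}ᶜ : Set E) → E) (fun y => (homeomorphUnitSphereProd E y).1)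
    fun _ => ⟨_, (NormedSpace.sphere_nonempty.2 zero_le_one).some_mem⟩

variable {E}

theorem sphereProj_coe (y : ({0}ᶜ : Set E)) :
    sphereProj E y = (homeomorphUnitSphereProd E y).1 :=
  Subtype.val_injective.extend_apply _ _ _

theorem coe_sphereProj {y : E} (hy : y ≠ 0) : (sphereProj E y : E) = ‖y‖⁻¹ • y := by
  lift y to ({0}ᶜ : Set E) using hy
  rw [sphereProj_coe]
  simp

theorem norm_smul_sphereProj {y : E} (hy : y ≠ 0) : ‖y‖ • (sphereProj E y : E) = y := by
  rw [coe_sphereProj hy, smul_inv_smul₀ (norm_ne_zero_iff.2 hy)]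

theorem sphereProj_smul {r : ℝ} (hr : 0 < r) {y : E} (hy : y ≠ 0) :
    sphereProj E (r • y) = sphereProj E y := by
  refine Subtype.ext ?_
  rw [coe_sphereProj hy, coe_sphereProj (smul_ne_zero hr.ne' hy), norm_smul, smul_smul,
    Real.norm_of_nonneg hr.le, mul_inv_rev, mul_assoc, inv_mul_cancel₀ hr.ne', mul_one]

theorem sphereProj_self (s : sphere (0 : E) 1) : sphereProj E s = s := by
  refine Subtype.ext ?_
  rw [coe_sphereProj (ne_zero_of_mem_unit_sphere s), norm_eq_of_mem_sphere s, inv_one, one_smul]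

theorem map_sphereProj_nhds {y : E} (hy : y ≠ 0) :
    map (sphereProj E) (𝓝 y) = 𝓝 (sphereProj E y) := by
  lift y to ({0}ᶜ : Set E) using hy
  rw [← isOpen_compl_singleton.isOpenEmbedding_subtypeVal.map_nhds_eq, Filter.map_map,
    funext_iff.2 (show ∀ y : ({0}ᶜ : Set E), (sphereProj E ∘ Subtype.val) y =
      (Prod.fst ∘ homeomorphUnitSphereProd E) y from sphereProj_coe), ← Filter.map_map,
    (homeomorphUnitSphereProd E).map_nhds_eq, sphereProj_coe]
  exact map_fst_nhds _

end SphereProj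

section Homogeneous

variable {E F : Type*} [NormedAddCommGroup E] [NormedSpace ℝ E] [Nontrivial E]
  [NormedAddCommGroup F] [NormedSpace ℝ F] [Nontrivial F]

/-- A homogeneous local homeomorphism induces a local homeomorphism of unit spheres. -/
theorem exists_collar_of_homogeneous [ProperSpace E] {K : E × ℝ → F}
    (hK : ∀ r : ℝ, 0 < r → ∀ x ≠ 0, ∀ t, K (r • x, t) = r • K (x, t))
    (hloc : ∀ s : sphere (0 : E) 1, ∃ Φ : OpenPartialHomeomorph (E × ℝ) F,
      ((s : E), (0 : ℝ)) ∈ Φ.source ∧ ⇑Φ = K)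
    {f : sphere (0 : E) 1 → sphere (0 : F) 1} (hf : Function.Injective f)
    (hKf : ∀ s : sphere (0 : E) 1, K (s, 0) = f s) :
    ∃ γ : sphere (0 : E) 1 × ℝ → sphere (0 : F) 1, InjOn γ {q | |q.2| < 2} ∧
      (∀ q : sphere (0 : E) 1 × ℝ, |q.2| < 2 → map γ (𝓝 q) = 𝓝 (γ q)) ∧ ∀ s, γ (s, 0) = f s := by
  set κ : sphere (0 : E) 1 × ℝ → F := fun q => K (q.1, q.2) with hκ
  set h : sphere (0 : E) 1 × ℝ → sphere (0 : F) 1 := sphereProj F ∘ κ with hh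
  have hh0 (s) : h (s, 0) = f s := by simp [hh, hκ, hKf, sphereProj_self]
  have hs0 (s : sphere (0 : E) 1) : (s : E) ≠ 0 := ne_zero_of_mem_unit_sphere s
  -- the point of the domain of `K` over `q'` with the same image norm as `q`
  set m : (sphere (0 : E) 1 × ℝ) × (sphere (0 : E) 1 × ℝ) → E × ℝ :=
    fun p => ((‖κ p.1‖ / ‖κ p.2‖) • (p.2.1 : E), p.2.2) with hm
  have key (s : sphere (0 : E) 1) : ∃ Φ : OpenPartialHomeomorph (E × ℝ) F, ⇑Φ = K ∧
      ∀ᶠ q in 𝓝 (s, (0 : ℝ)), κ q ≠ 0 ∧ ((q.1 : E), q.2) ∈ Φ.source ∧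
        (ContinuousAt κ q) := by
    obtain ⟨Φ, hΦs, hΦ⟩ := hloc s
    refine ⟨Φ, hΦ, ?_⟩
    have hcoe : Continuous fun q : sphere (0 : E) 1 × ℝ => ((q.1 : E), q.2) := by fun_prop
    have hc : ∀ q : sphere (0 : E) 1 × ℝ, ((q.1 : E), q.2) ∈ Φ.source → ContinuousAt κ q :=
      fun q hq => ContinuousAt.comp (g := K) (hΦ ▸ Φ.continuousAt hq) hcoe.continuousAt
    have h1 : ∀ᶠ q in 𝓝 (s, (0 : ℝ)), ((q.1 : E), q.2) ∈ Φ.source :=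
      hcoe.continuousAt.eventually_mem (Φ.open_source.mem_nhds hΦs)
    have h2 : ∀ᶠ q in 𝓝 (s, (0 : ℝ)), κ q ≠ 0 := by
      refine (hc (s, 0) hΦs).eventually_ne ?_
      simp only [hκ, hKf]
      exact ne_zero_of_mem_unit_sphere (f s)
    filter_upwards [h1, h2] with q hq1 hq2 using ⟨hq2, hq1, hc q hq1⟩
  obtain ⟨γ, h1, h2, h3⟩ := exists_collar (h := h)
    (by simpa only [hh0] using hf)
    (fun s => by
      obtain ⟨Φ, hΦ, hev⟩ := key s
      filter_upwards [hev] with q hq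
      obtain ⟨hq0, hqs, -⟩ := hq
      set P : E × ℝ → sphere (0 : E) 1 × ℝ := Prod.map (sphereProj E) id with hP
      have hPq : P ((q.1 : E), q.2) = q := by simp [hP, sphereProj_self]
      have hPm : map P (𝓝 ((q.1 : E), q.2)) = 𝓝 q := by
        rw [nhds_prod_eq, hP, ← Filter.prod_map_map_eq', map_sphereProj_nhds (hs0 q.1),
          sphereProj_self, map_id, ← nhds_prod_eq]
      have hKm : map K (𝓝 ((q.1 : E), q.2)) = 𝓝 (κ q) := by
        rw [← hΦ, Φ.map_nhds_eq hqs, hΦ]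
      rw [← hPm, Filter.map_map, Filter.map_congr (m₂ := sphereProj F ∘ K), ← Filter.map_map, hKm,
        map_sphereProj_nhds hq0]
      · rfl
      · filter_upwards [(isOpen_ne.preimage continuous_fst).mem_nhds (hs0 q.1),
          (Φ.continuousAt hqs).eventually_ne (by rw [hΦ]; exact hq0)] with w hw1 hw2
        have hn := norm_pos_iff.2 hw1
        rw [hΦ] at hw2
        have hKw := hK ‖w.1‖ hn (sphereProj E w.1) (hs0 _) w.2
        rw [norm_smul_sphereProj hw1] at hKw
        have hne : K ((sphereProj E w.1 : E), w.2) ≠ 0 := fun h0 => hw2 (by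
          rw [h0, smul_zero] at hKw; exact hKw)
        change sphereProj F (K ((sphereProj E w.1 : E), w.2)) = sphereProj F (K w)
        rw [← sphereProj_smul hn hne, ← hKw])
    (fun s => by
      obtain ⟨Φ, hΦ, hev⟩ := key s
      obtain ⟨hs1, hs2, hs3⟩ := hev.self_of_nhds
      have hmc : ContinuousAt m ((s, 0), (s, 0)) := by
        have hκ1 : ContinuousAt (fun p : (sphere (0 : E) 1 × ℝ) × (sphere (0 : E) 1 × ℝ) => κ p.1)
            ((s, 0), (s, 0)) := ContinuousAt.comp (g := κ) hs3 continuousAt_fst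
        have hκ2 : ContinuousAt (fun p : (sphere (0 : E) 1 × ℝ) × (sphere (0 : E) 1 × ℝ) => κ p.2)
            ((s, 0), (s, 0)) := ContinuousAt.comp (g := κ) hs3 continuousAt_snd
        exact ((hκ1.norm.div hκ2.norm (norm_ne_zero_iff.2 hs1)).smul (by fun_prop)).prodMk
          (by fun_prop)
      have hms : m ((s, 0), (s, 0)) ∈ Φ.source := by
        simpa only [hm, div_self (norm_ne_zero_iff.2 hs1), one_smul] using hs2
      have hmev := hmc.eventually_mem (Φ.open_source.mem_nhds hms)
      rw [nhds_prod_eq] at hmev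
      obtain ⟨u, hu, hum⟩ :=
        eventually_prod_self_iff (r := fun a b => m (a, b) ∈ Φ.source) |>.1 hmev
      refine ⟨u ∩ {q | κ q ≠ 0 ∧ ((q.1 : E), q.2) ∈ Φ.source ∧ (ContinuousAt κ q)},
        inter_mem hu hev, ?_⟩
      rintro q ⟨hqu, hq0, hqs, -⟩ w ⟨hwu, hw0, hws, -⟩ hqw
      have hnq := norm_pos_iff.2 hq0
      have hnw := norm_pos_iff.2 hw0
      have hr : 0 < ‖κ q‖ / ‖κ w‖ := div_pos hnq hnw
      have heq : K ((q.1 : E), q.2) = K (m (q, w)) := by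
        simp only [hm]
        rw [hK _ hr _ (hs0 w.1)]
        change κ q = (‖κ q‖ / ‖κ w‖) • κ w
        rw [div_eq_mul_inv, mul_smul, ← coe_sphereProj hw0, ← norm_smul_sphereProj hq0]
        simp only [hh, Function.comp] at hqw
        rw [hqw, norm_smul, norm_norm, norm_eq_of_mem_sphere, mul_one]
      have := Φ.injOn hqs (hum q hqu w hwu) (by rw [hΦ, heq])
      obtain ⟨e1, e2⟩ := Prod.ext_iff.1 this
      have e3 := congrArg (fun x => sphereProj E x) e1
      simp only [hm, sphereProj_smul hr (hs0 w.1), sphereProj_self] at e3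
      exact Prod.ext e3 e2)
  exact ⟨γ, h1, h2, fun s => (h3 s).trans (hh0 s)⟩

end Homogeneous

section CrossProduct

variable {n : ℕ}

/-- The generalized cross product of the images of the standard basis under a linear map from
`ℝⁿ` to `ℝⁿ⁺¹`. -/
def crossProductOf (A : EuclideanSpace ℝ (Fin n) →L[ℝ] EuclideanSpace ℝ (Fin (n + 1))) :
    EuclideanSpace ℝ (Fin (n + 1)) :=
  WithLp.toLp 2 fun i => (-1) ^ (i : ℕ) *
    (Matrix.of fun j k => A (EuclideanSpace.single j 1) (i.succAbove k)).det

theorem inner_crossProductOf (A : EuclideanSpace ℝ (Fin n) →L[ℝ] EuclideanSpace ℝ (Fin (n + 1)))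
    (w : EuclideanSpace ℝ (Fin (n + 1))) :
    inner ℝ (crossProductOf A) w =
      (Matrix.of (Fin.cons w.ofLp fun j => (A (EuclideanSpace.single j 1)).ofLp)).det := by
  rw [Matrix.det_succ_row_zero, PiLp.inner_apply]
  refine Finset.sum_congr rfl fun i _ => ?_
  simp only [crossProductOf, RCLike.inner_apply, conj_trivial, Matrix.of_apply, Fin.cons_zero]
  rw [mul_left_comm, mul_assoc]
  congr 2

theorem inner_crossProductOf_apply
    (A : EuclideanSpace ℝ (Fin n) →L[ℝ] EuclideanSpace ℝ (Fin (n + 1)))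
    (x : EuclideanSpace ℝ (Fin n)) : inner ℝ (crossProductOf A) (A x) = 0 := by
  have : (innerSL ℝ (crossProductOf A)).comp A = 0 := by
    refine ContinuousLinearMap.coe_injective ((EuclideanSpace.basisFun _ ℝ).toBasis.ext fun j => ?_)
    simp only [OrthonormalBasis.coe_toBasis, EuclideanSpace.basisFun_apply]
    exact (inner_crossProductOf A _).trans
      (Matrix.det_zero_of_row_eq (Fin.succ_ne_zero j).symm (by ext; simp))
  exact DFunLike.congr_fun this x

theorem crossProductOf_ne_zero
    {A : EuclideanSpace ℝ (Fin n) →L[ℝ] EuclideanSpace ℝ (Fin (n + 1))}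
    (hA : Function.Injective A) : crossProductOf A ≠ 0 := by
  have hb := (EuclideanSpace.basisFun (Fin n) ℝ).toBasis.linearIndependent.map'
    (A : EuclideanSpace ℝ (Fin n) →ₗ[ℝ] EuclideanSpace ℝ (Fin (n + 1))) (LinearMap.ker_eq_bot.2 hA)
  obtain ⟨w, hw⟩ := exists_linearIndependent_cons_of_lt_finrank hb (by simp)
  have hl := hw.map' (WithLp.linearEquiv 2 ℝ (Fin (n + 1) → ℝ)).toLinearMap (LinearEquiv.ker _)
  have hdet :
      (Matrix.of (Fin.cons w.ofLp fun j => (A (EuclideanSpace.single j 1)).ofLp)).det ≠ 0 := by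
    rw [← isUnit_iff_ne_zero, ← Matrix.isUnit_iff_isUnit_det,
      ← Matrix.linearIndependent_rows_iff_isUnit]
    have hrow : (Matrix.of (Fin.cons w.ofLp
        fun j => (A (EuclideanSpace.single j 1)).ofLp)).row = WithLp.linearEquiv 2 ℝ _ ∘
          Fin.cons w (A ∘ (EuclideanSpace.basisFun (Fin n) ℝ).toBasis) := by
      funext i
      refine Fin.cases ?_ (fun j => ?_) i <;> ext <;> simp
    rw [hrow]
    exact hl
  intro h0
  rw [← inner_crossProductOf, h0, inner_zero_left] at hdet
  exact hdet rfl

theorem contDiff_crossProductOf {m : WithTop ℕ∞} : ContDiff ℝ m (crossProductOf (n := n)) := by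
  rw [contDiff_euclidean]
  intro i
  simp only [crossProductOf, Matrix.det_apply, Matrix.of_apply]
  fun_prop

end CrossProduct

section RadialExtension

variable {E F : Type*} [NormedAddCommGroup E] [InnerProductSpace ℝ E] [Nontrivial E]
  [NormedAddCommGroup F] [InnerProductSpace ℝ F]

/-- The homogeneous extension of a map between unit spheres. -/
def radialExtension (f : sphere (0 : E) 1 → sphere (0 : F) 1) (x : E) : F :=
  ‖x‖ • (f (sphereProj E x) : F)

theorem radialExtension_coe (f : sphere (0 : E) 1 → sphere (0 : F) 1) (s : sphere (0 : E) 1) :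
    radialExtension f s = f s := by
  rw [radialExtension, norm_eq_of_mem_sphere, one_smul, sphereProj_self]

theorem norm_radialExtension (f : sphere (0 : E) 1 → sphere (0 : F) 1) (x : E) :
    ‖radialExtension f x‖ = ‖x‖ := by
  rw [radialExtension, norm_smul, norm_norm, norm_eq_of_mem_sphere, mul_one]

variable {n m : ℕ} [Fact (finrank ℝ E = n + 1)] [Fact (finrank ℝ F = m + 1)]

theorem contDiffAt_radialExtension {k : ℕ∞} {f : sphere (0 : E) 1 → sphere (0 : F) 1}
    (hf : ContMDiff (𝓡 n) (𝓡 m) k f) {x : E} (hx : x ≠ 0) :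
    ContDiffAt ℝ k (radialExtension f) x := by
  set U : TopologicalSpace.Opens E := ⟨{0}ᶜ, isOpen_compl_singleton⟩
  have h1 : ContMDiff 𝓘(ℝ, E) 𝓘(ℝ, E) k (fun y : U => ‖(y : E)‖⁻¹ • (y : E)) := fun y =>
    contMDiffAt_subtype_iff (f := fun y : E => ‖y‖⁻¹ • y) |>.2
      (((contDiffAt_norm ℝ y.2).inv (norm_ne_zero_iff.2 y.2)).smul contDiffAt_id).contMDiffAt
  have h2 := h1.codRestrict_sphere (n := n) fun y => by
    rw [mem_sphere_zero_iff_norm, norm_smul, norm_inv, norm_norm,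
      inv_mul_cancel₀ (norm_ne_zero_iff.2 y.2)]
  have h3 : ContMDiff 𝓘(ℝ, E) 𝓘(ℝ, F) k (fun y : U => (f (sphereProj E y) : F)) := by
    refine ((contMDiff_coe_sphere.comp hf).comp h2).congr fun y => ?_
    exact congrArg (fun s => (f s : F)) (Subtype.ext (coe_sphereProj y.2))
  have h4 : ContMDiffAt 𝓘(ℝ, E) 𝓘(ℝ, F) k (fun y : E => (f (sphereProj E y) : F)) x :=
    contMDiffAt_subtype_iff (x := (⟨x, hx⟩ : U)) |>.1 h3.contMDiffAt
  exact (contDiffAt_norm ℝ hx).smul h4.contDiffAt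

theorem injective_fderiv_radialExtension {f : sphere (0 : E) 1 → sphere (0 : F) 1} {k : ℕ∞}
    (hk : (k : WithTop ℕ∞) ≠ 0) (hf : ContMDiff (𝓡 n) (𝓡 m) k f) {s : sphere (0 : E) 1}
    (hs : Function.Injective (mfderiv (𝓡 n) (𝓡 m) f s)) :
    Function.Injective (fderiv ℝ (radialExtension f) s) := by
  have hs0 : (s : E) ≠ 0 := ne_zero_of_mem_unit_sphere s
  have hd : HasFDerivAt (radialExtension f) (fderiv ℝ (radialExtension f) s) (s : E) :=
    ((contDiffAt_radialExtension hf hs0).differentiableAt hk).hasFDerivAt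
  refine (injective_iff_map_eq_zero _).2 fun v hv => ?_
  have horth : inner ℝ (s : E) v = 0 := by
    have h1 := hd.inner ℝ hd
    have h2 := (hasFDerivAt_id (𝕜 := ℝ) (s : E)).inner ℝ (hasFDerivAt_id (𝕜 := ℝ) (s : E))
    have h3 : (fun x => inner ℝ (radialExtension f x) (radialExtension f x)) =
        fun x : E => inner ℝ (id x) (id x) := by
      ext x
      simp [norm_radialExtension]
    have h4 := DFunLike.congr_fun ((h3 ▸ h1).unique h2) v
    simp [hv] at h4
    linarith [real_inner_comm (s : E) v]
  have hmem : v ∈ (mfderiv (𝓡 n) 𝓘(ℝ, E) ((↑) : sphere (0 : E) 1 → E) s :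
      TangentSpace (𝓡 n) s →L[ℝ] E).range := by
    rw [show (mfderiv (𝓡 n) 𝓘(ℝ, E) ((↑) : sphere (0 : E) 1 → E) s :
      TangentSpace (𝓡 n) s →L[ℝ] E).range = (ℝ ∙ (s : E))ᗮ from range_mvfderiv_subtypeVal s]
    exact Submodule.mem_orthogonal_singleton_iff_inner_right.2 horth
  obtain ⟨w, rfl⟩ := hmem
  have hG : MDifferentiableAt 𝓘(ℝ, E) 𝓘(ℝ, F) (radialExtension f) (s : E) :=
    hd.differentiableAt.mdifferentiableAt
  have hι : MDifferentiableAt (𝓡 n) 𝓘(ℝ, E) ((↑) : sphere (0 : E) 1 → E) s :=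
    (contMDiff_coe_sphere (m := 1)).mdifferentiable one_ne_zero s
  have hι' : MDifferentiableAt (𝓡 m) 𝓘(ℝ, F) ((↑) : sphere (0 : F) 1 → F) (f s) :=
    (contMDiff_coe_sphere (m := 1)).mdifferentiable one_ne_zero (f s)
  have h1 := mfderiv_comp s hG hι
  have h2 := mfderiv_comp s hι' (hf.mdifferentiable hk s)
  rw [show radialExtension f ∘ (↑) = (↑) ∘ f from funext (radialExtension_coe f), h2,
    mfderiv_eq_fderiv] at h1
  have h3 : mfderiv (𝓡 m) 𝓘(ℝ, F) ((↑) : sphere (0 : F) 1 → F) (f s)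
      (mfderiv (𝓡 n) (𝓡 m) f s w) = 0 := (DFunLike.congr_fun h1 w).trans hv
  have h4 : mfderiv (𝓡 n) (𝓡 m) f s w = 0 :=
    (injective_iff_map_eq_zero _).1 (injective_mvfderiv_subtypeVal_sphere (f s)) _ h3
  rw [(injective_iff_map_eq_zero _).1 hs w h4]
  exact map_zero _

end RadialExtension

section NormalCollar

variable {n : ℕ}

/-- The homogeneous parametrization of a neighbourhood of the cone over an embedded sphere by
means of a normal field. -/
def coneCollar (f : sphere (0 : EuclideanSpace ℝ (Fin (n + 1))) 1 →
    sphere (0 : EuclideanSpace ℝ (Fin (n + 1 + 1))) 1)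
    (q : EuclideanSpace ℝ (Fin (n + 1)) × ℝ) : EuclideanSpace ℝ (Fin (n + 1 + 1)) :=
  radialExtension f q.1 + (q.2 * ‖q.1‖) •
    crossProductOf (fderiv ℝ (radialExtension f) (‖q.1‖⁻¹ • q.1))

theorem coneCollar_smul (f : sphere (0 : EuclideanSpace ℝ (Fin (n + 1))) 1 →
    sphere (0 : EuclideanSpace ℝ (Fin (n + 1 + 1))) 1) {r : ℝ} (hr : 0 < r)
    {x : EuclideanSpace ℝ (Fin (n + 1))} (hx : x ≠ 0) (t : ℝ) :
    coneCollar f (r • x, t) = r • coneCollar f (x, t) := by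
  have h1 : ‖r • x‖ = r * ‖x‖ := by rw [norm_smul, Real.norm_of_nonneg hr.le]
  have h2 : (r * ‖x‖)⁻¹ • r • x = ‖x‖⁻¹ • x := by
    rw [smul_smul]
    congr 1
    field_simp
  simp only [coneCollar, radialExtension, sphereProj_smul hr hx, h1, h2, smul_add, smul_smul]
  congr 2
  ring

variable {f : sphere (0 : EuclideanSpace ℝ (Fin (n + 1))) 1 →
    sphere (0 : EuclideanSpace ℝ (Fin (n + 1 + 1))) 1}

theorem contDiffAt_coneCollar
    (hf : ContMDiff (𝓡 n) (𝓡 (n + 1)) (⊤ : ℕ∞) f) {x : EuclideanSpace ℝ (Fin (n + 1))}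
    (hx : x ≠ 0) (t : ℝ) : ContDiffAt ℝ 1 (coneCollar f) (x, t) := by
  have (k : ℕ) : Fact (finrank ℝ (EuclideanSpace ℝ (Fin k)) = k) := ⟨finrank_euclideanSpace_fin⟩
  have hn : ContDiffAt ℝ 1 (fun q : EuclideanSpace ℝ (Fin (n + 1)) × ℝ => ‖q.1‖) (x, t) :=
    (contDiffAt_norm ℝ hx).comp (x, t) contDiffAt_fst
  have hG {y : EuclideanSpace ℝ (Fin (n + 1))} (hy : y ≠ 0) :
      ContDiffAt ℝ (1 + 1) (radialExtension f) y :=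
    (contDiffAt_radialExtension hf hy).of_le (by norm_cast)
  have hy : ‖x‖⁻¹ • x ≠ 0 := smul_ne_zero (inv_ne_zero (norm_ne_zero_iff.2 hx)) hx
  have hfd : ContDiffAt ℝ 1 (fderiv ℝ (radialExtension f)) (‖x‖⁻¹ • x) :=
    (hG hy).fderiv_right le_rfl
  have h1 : ContDiffAt ℝ 1 (fun q : EuclideanSpace ℝ (Fin (n + 1)) × ℝ => ‖q.1‖⁻¹ • q.1) (x, t) :=
    (hn.inv (norm_ne_zero_iff.2 hx)).smul contDiffAt_fst
  have h2 := contDiff_crossProductOf.contDiffAt.comp (x, t) (hfd.comp (x, t) h1)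
  have h3 : ContDiffAt ℝ 1 (radialExtension f) x := (hG hx).of_le le_self_add
  exact (h3.comp (x, t) contDiffAt_fst).add ((contDiffAt_snd.mul hn).smul h2)

theorem injective_fderiv_coneCollar (hf : ContMDiff (𝓡 n) (𝓡 (n + 1)) (⊤ : ℕ∞) f)
    {s : sphere (0 : EuclideanSpace ℝ (Fin (n + 1))) 1}
    (hs : Function.Injective (mfderiv (𝓡 n) (𝓡 (n + 1)) f s)) :
    Function.Injective
      (fderiv ℝ (coneCollar f) ((s : EuclideanSpace ℝ (Fin (n + 1))), (0 : ℝ))) := by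
  have (k : ℕ) : Fact (finrank ℝ (EuclideanSpace ℝ (Fin k)) = k) := ⟨finrank_euclideanSpace_fin⟩
  have hs0 : (s : EuclideanSpace ℝ (Fin (n + 1))) ≠ 0 := ne_zero_of_mem_unit_sphere s
  set L := fderiv ℝ (coneCollar f) ((s : EuclideanSpace ℝ (Fin (n + 1))), (0 : ℝ)) with hL
  set A := fderiv ℝ (radialExtension f) (s : EuclideanSpace ℝ (Fin (n + 1))) with hA
  have hAinj : Function.Injective A := injective_fderiv_radialExtension (by simp) hf hs
  have hd : HasFDerivAt (coneCollar f) L (s, 0) :=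
    ((contDiffAt_coneCollar hf hs0 0).differentiableAt one_ne_zero).hasFDerivAt
  have h1 (v : EuclideanSpace ℝ (Fin (n + 1))) : L (v, 0) = A v := by
    have h := HasFDerivAt.comp (f := fun x => (id x, (0 : ℝ))) _ hd
      ((hasFDerivAt_id _).prodMk (hasFDerivAt_const (0 : ℝ) _))
    have h' : coneCollar f ∘ (fun x => (id x, (0 : ℝ))) = radialExtension f := by
      ext1 x
      simp [coneCollar]
    rw [h'] at h
    exact (DFunLike.congr_fun h.fderiv v).symm
  have h2 (r : ℝ) : L (0, r) = r • crossProductOf A := by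
    have h := HasFDerivAt.comp
      (f := fun t : ℝ => ((s : EuclideanSpace ℝ (Fin (n + 1))), id t)) (0 : ℝ) hd
      ((hasFDerivAt_const _ _).prodMk (hasFDerivAt_id _))
    have h' : HasFDerivAt (coneCollar f ∘ fun t : ℝ => ((s : EuclideanSpace ℝ (Fin (n + 1))), id t))
        ((ContinuousLinearMap.id ℝ ℝ).smulRight (crossProductOf A)) 0 := by
      have h'' : coneCollar f ∘ (fun t : ℝ => ((s : EuclideanSpace ℝ (Fin (n + 1))), id t)) =
          fun t => (f s : EuclideanSpace ℝ (Fin (n + 1 + 1))) + t • crossProductOf A := by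
        ext1 t
        simp [coneCollar, radialExtension_coe, hA]
      rw [h'']
      exact ((hasFDerivAt_id _).smul_const _).const_add _
    exact DFunLike.congr_fun (h.unique h') r
  refine (injective_iff_map_eq_zero _).2 fun ⟨v, r⟩ hvr => ?_
  have h3 : A v + r • crossProductOf A = 0 := by
    rw [← h1, ← h2, ← map_add, Prod.mk_add_mk, add_zero, zero_add, hvr]
  have hr : r = 0 := by
    have h4 := congrArg (inner ℝ (crossProductOf A)) h3
    rw [inner_add_right, inner_crossProductOf_apply, inner_smul_right, zero_add, inner_zero_right,
      mul_eq_zero, inner_self_eq_zero] at h4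
    exact h4.resolve_right (crossProductOf_ne_zero hAinj)
  subst hr
  rw [zero_smul, add_zero] at h3
  rw [(injective_iff_map_eq_zero _).1 hAinj v h3]
  rfl

theorem exists_openPartialHomeomorph_coneCollar (hf : ContMDiff (𝓡 n) (𝓡 (n + 1)) (⊤ : ℕ∞) f)
    {s : sphere (0 : EuclideanSpace ℝ (Fin (n + 1))) 1}
    (hs : Function.Injective (mfderiv (𝓡 n) (𝓡 (n + 1)) f s)) :
    ∃ Φ : OpenPartialHomeomorph (EuclideanSpace ℝ (Fin (n + 1)) × ℝ)
      (EuclideanSpace ℝ (Fin (n + 1 + 1))),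
      ((s : EuclideanSpace ℝ (Fin (n + 1))), (0 : ℝ)) ∈ Φ.source ∧ ⇑Φ = coneCollar f := by
  have hinj := injective_fderiv_coneCollar hf hs
  set L := fderiv ℝ (coneCollar f) ((s : EuclideanSpace ℝ (Fin (n + 1))), (0 : ℝ)) with hL
  have hd : HasStrictFDerivAt (coneCollar f) L (s, 0) :=
    (contDiffAt_coneCollar hf (ne_zero_of_mem_unit_sphere s) 0).hasStrictFDerivAt one_ne_zero
  let e : (EuclideanSpace ℝ (Fin (n + 1)) × ℝ) ≃L[ℝ] EuclideanSpace ℝ (Fin (n + 1 + 1)) :=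
    (LinearEquiv.ofInjectiveOfFinrankEq (L : _ →ₗ[ℝ] _) hinj (by simp)).toContinuousLinearEquiv
  have he : HasStrictFDerivAt (coneCollar f)
      (e : (EuclideanSpace ℝ (Fin (n + 1)) × ℝ) →L[ℝ] EuclideanSpace ℝ (Fin (n + 1 + 1)))
      ((s : EuclideanSpace ℝ (Fin (n + 1))), (0 : ℝ)) := by
    rwa [show (e : _ →L[ℝ] _) = L from rfl]
  exact ⟨he.toOpenPartialHomeomorph _, he.mem_toOpenPartialHomeomorph_source, rfl⟩

/-- The Schoenflies theorem for smoothly embedded spheres of codimension one. -/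
theorem schoenflies_of_contMDiff {n : ℕ} (hn : 1 ≤ n)
    {f : sphere (0 : EuclideanSpace ℝ (Fin (n + 1))) 1 →
      sphere (0 : EuclideanSpace ℝ (Fin (n + 1 + 1))) 1}
    (hf : ContMDiff (𝓡 n) (𝓡 (n + 1)) (⊤ : ℕ∞) f) (hinj : Function.Injective f)
    (himm : ∀ s, Function.Injective (mfderiv (𝓡 n) (𝓡 (n + 1)) f s))
    {x : sphere (0 : EuclideanSpace ℝ (Fin (n + 1 + 1))) 1} (hx : x ∉ range f) :
    Nonempty ((closure (connectedComponentIn (range f)ᶜ x) :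
      Set (sphere (0 : EuclideanSpace ℝ (Fin (n + 1 + 1))) 1)) ≃ₜ
        closedBall (0 : EuclideanSpace ℝ (Fin (n + 1))) 1) := by
  have (k : ℕ) : Fact (finrank ℝ (EuclideanSpace ℝ (Fin k)) = k) := ⟨finrank_euclideanSpace_fin⟩
  obtain ⟨γ, hγinj, hγmap, hγ⟩ := exists_collar_of_homogeneous
    (fun _ hr _ hx t => coneCollar_smul f hr hx t)
    (fun s => exists_openPartialHomeomorph_coneCollar hf (himm s)) hinj
    (fun s => by simp [coneCollar, radialExtension_coe])
  have hrange : f = fun s => γ (s, 0) := funext fun s => (hγ s).symm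
  subst hrange
  have hrank : 1 < Module.rank ℝ (EuclideanSpace ℝ (Fin (n + 1))) := by
    rw [← Module.finrank_eq_rank, finrank_euclideanSpace_fin]
    exact_mod_cast Nat.lt_succ_of_le hn
  exact (hasPuncturedCells_sphere (n + 1)).nonempty_homeomorph_closedBall hrank hγinj hγmap hx

end NormalCollar

end Schoenflies

/-- Mazur's Schoenflies theorem: each closed complementary region of a smoothly embedded
3-sphere in `S⁴` is homeomorphic to the closed 4-ball. -/
theorem mazur_schoenflies (f : S3 → S4) (hf : IsS3Embedding (𝓡 4) f) :
    ∀ x : S4, x ∉ Set.range f →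
      Nonempty
        ((closure (connectedComponentIn (Set.range f)ᶜ x) : Set S4) ≃ₜ
          (Metric.closedBall (0 : EuclideanSpace ℝ (Fin 4)) 1)) := by
  obtain ⟨hsm, hinj, -, himm⟩ := hf
  exact fun x hx => schoenflies_of_contMDiff (by norm_num) hsm hinj himm hx

end
end

section
/- Interpolation is an equivalence relation on Diff₀(V): every φ ∈ Diff₀(V) interpolates to itself; if φ interpolates to ψ then ψ interpolates to φ; and if φ interpolates to ψ and ψ interpolates to χ then φ interpolates to χ. (Corollary to Proposition 1.9 of the paper.) -/
open scoped Manifold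
open Metric Set Module

noncomputable section

/-- The 4-manifold `V = S¹ × S³`. -/
abbrev V : Type := Circle × S3

/-- The model for `V`. -/
abbrev IV := (𝓡 1).prod (𝓡 3)

/-- The model for `ℝ × S³`. -/
abbrev IRS := 𝓘(ℝ, ℝ).prod (𝓡 3)

/-- The universal covering `ℝ × S³ → V`, `(t, w) ↦ (exp t, w)`. -/
def pcov : ℝ × S3 → V := fun q => (Circle.exp q.1, q.2)

/-- The `n`-fold covering `V → V`, `(z, w) ↦ (zⁿ, w)`. -/
def pcovN (n : ℕ) : V → V := fun q => (q.1 ^ n, q.2)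

/-- Membership in `Diff₀(V)`: a diffeomorphism of `V` homotopic to the identity. -/
def InDiff0 (φ : V → V) : Prop :=
  IsDiffeoB IV IV φ ∧ ∃ hc : Continuous φ,
    ContinuousMap.Homotopic ⟨φ, hc⟩ (ContinuousMap.id V)

/-- A lift of `φ : V → V` to the `n`-fold cover. -/
def IsLiftN (n : ℕ) (φ φh : V → V) : Prop :=
  IsDiffeoB IV IV φh ∧ ∀ q : V, pcovN n (φh q) = φ (pcovN n q)

/-- A lift of `φ : V → V` to the universal cover `ℝ × S³`. -/
def IsLiftU (φ : V → V) (φt : ℝ × S3 → ℝ × S3) : Prop :=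
  IsDiffeoB IRS IRS φt ∧ ∀ q : ℝ × S3, pcov (φt q) = φ (pcov q)

/-- S-equivalence of elements of `Diff₀(V)`. -/
def SEquiv (φ ψ : V → V) : Prop :=
  ∃ n : ℕ, 1 ≤ n ∧ ∃ φh ψh : V → V, IsLiftN n φ φh ∧ IsLiftN n ψ ψh ∧
    ∃ z₀ : Circle,
      AmbIsotopic IV (φh '' (({z₀} : Set Circle) ×ˢ (Set.univ : Set S3)))
        (ψh '' (({z₀} : Set Circle) ×ˢ (Set.univ : Set S3)))

/-- `φ` interpolates to `ψ`: some lift of `φ` can be glued to some lift of `ψ` by a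
diffeomorphism of `ℝ × S³` agreeing with the first near `-∞` and the second near `+∞`. -/
def Interpolates (φ ψ : V → V) : Prop :=
  ∃ φt ψt h : ℝ × S3 → ℝ × S3, IsLiftU φ φt ∧ IsLiftU ψ ψt ∧
    IsDiffeoB IRS IRS h ∧ ∃ a b : ℝ, a ≤ b ∧
      (∀ q : ℝ × S3, q.1 ≤ a → h q = φt q) ∧
      (∀ q : ℝ × S3, b ≤ q.1 → h q = ψt q)

/-- A continuous real function whose circle exponential is smooth is itself smooth. -/
theorem ContMDiff.of_circleExp_comp {E H M : Type*} [NormedAddCommGroup E] [NormedSpace ℝ E]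
    [TopologicalSpace H] {I : ModelWithCorners ℝ E H} [TopologicalSpace M] [ChartedSpace H M]
    {n : ℕ∞} {f : M → ℝ} (hf : Continuous f)
    (he : ContMDiff I (𝓡 1) n (fun x => Circle.exp (f x))) :
    ContMDiff I 𝓘(ℝ, ℝ) n f := by
  intro x
  have := finrank_real_complex_fact'
  have hc : ContMDiff I 𝓘(ℝ, ℂ) n (fun y => ((Circle.exp (f y) : Circle) : ℂ)) :=
    (contMDiff_coe_sphere (E := ℂ) (n := 1)).comp he
  let A : ℂ → ℝ := fun z => f x + (Complex.log (z * (Circle.exp (-f x) : Circle))).im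
  have hA : ContDiffAt ℝ n A ((Circle.exp (f x) : Circle) : ℂ) := by
    have h1 : ((Circle.exp (f x) : Circle) : ℂ) * (Circle.exp (-f x) : Circle) = 1 := by
      rw [← Circle.coe_mul, ← Circle.exp_add]; simp
    have h2 : ContDiffAt ℝ n Complex.log
        (((Circle.exp (f x) : Circle) : ℂ) * (Circle.exp (-f x) : Circle)) := by
      rw [h1]
      exact (Complex.contDiffAt_log Complex.one_mem_slitPlane).restrict_scalars ℝ
    have h3 : ContDiffAt ℝ n (fun z : ℂ => z * ((Circle.exp (-f x) : Circle) : ℂ))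
        ((Circle.exp (f x) : Circle) : ℂ) := contDiffAt_id.mul contDiffAt_const
    exact contDiffAt_const.add
      (Complex.imCLM.contDiff.contDiffAt.comp _ (ContDiffAt.comp (g := Complex.log) (Circle.exp (f x) : ℂ) h2 h3))
  have hcomp : ContMDiffAt I 𝓘(ℝ, ℝ) n (fun y => A ((Circle.exp (f y) : Circle) : ℂ)) x :=
    ContMDiffAt.comp (g := A) x hA.contMDiffAt (hc x)
  refine hcomp.congr_of_eventuallyEq ?_
  have hev : ∀ᶠ y in nhds x, dist (f y) (f x) < Real.pi :=
    hf.continuousAt.eventually (Metric.ball_mem_nhds _ Real.pi_pos)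
  filter_upwards [hev] with y hy
  rw [Real.dist_eq, abs_lt] at hy
  have h4 : (Complex.log (((Circle.exp (f y) : Circle) : ℂ) * (Circle.exp (-f x) : Circle))).im
      = f y - f x := by
    rw [← Circle.coe_mul, ← Circle.exp_add, Complex.log_im,
      Circle.arg_exp (by linarith) (by linarith)]
    ring
  simp only [A, h4]
  ring

instance : ConnectedSpace S3 := by
  refine Subtype.connectedSpace (isConnected_sphere ?_ _ zero_le_one)
  rw [← Module.finrank_eq_rank, finrank_euclideanSpace_fin]
  norm_num

/-- Translation of the line factor of `ℝ × S³`. -/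
def lineShift (c : ℝ) : ℝ × S3 → ℝ × S3 := fun q => (q.1 + c, q.2)

theorem contMDiff_lineShift (c : ℝ) : ContMDiff IRS IRS (⊤ : ℕ∞) (lineShift c) :=
  ContMDiff.prodMk (contMDiff_fst.add contMDiff_const) contMDiff_snd

theorem lineShift_lineShift (c d : ℝ) (q : ℝ × S3) :
    lineShift c (lineShift d q) = lineShift (d + c) q := by
  simp [lineShift, add_assoc]

theorem lineShift_zero (q : ℝ × S3) : lineShift 0 q = q := by
  simp [lineShift]

theorem lineShift_neg_lineShift (c : ℝ) (q : ℝ × S3) : lineShift (-c) (lineShift c q) = q := by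
  rw [lineShift_lineShift, add_neg_cancel, lineShift_zero]

theorem lineShift_lineShift_neg (c : ℝ) (q : ℝ × S3) : lineShift c (lineShift (-c) q) = q := by
  rw [lineShift_lineShift, neg_add_cancel, lineShift_zero]

theorem IsDiffeoB.comp {f g : ℝ × S3 → ℝ × S3} (hg : IsDiffeoB IRS IRS g)
    (hf : IsDiffeoB IRS IRS f) : IsDiffeoB IRS IRS (fun q => g (f q)) := by
  obtain ⟨sg, g', sg', lg, rg⟩ := hg
  obtain ⟨sf, f', sf', lf, rf⟩ := hf
  exact ⟨sg.comp sf, fun q => f' (g' q), sf'.comp sg', fun q => by simp [lg (f q), lf q],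
    fun q => by simp [rf (g' q), rg q]⟩

theorem isDiffeoB_lineShift (c : ℝ) : IsDiffeoB IRS IRS (lineShift c) :=
  ⟨contMDiff_lineShift c, lineShift (-c), contMDiff_lineShift (-c),
    lineShift_neg_lineShift c, lineShift_lineShift_neg c⟩

theorem pcov_lineShift (k : ℤ) (q : ℝ × S3) : pcov (lineShift (k * (2 * Real.pi)) q) = pcov q := by
  simp only [pcov, lineShift]
  rw [Circle.exp_add, Circle.exp_int_mul_two_pi, mul_one]

theorem IsLiftU.lineShift {φ : V → V} {f : ℝ × S3 → ℝ × S3} (hf : IsLiftU φ f) {c : ℝ}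
    (hc : ∀ q, pcov (lineShift c q) = pcov q) : IsLiftU φ (fun q => lineShift c (f q)) :=
  ⟨(isDiffeoB_lineShift c).comp hf.1, fun q => by rw [hc, hf.2]⟩

/-- Continuous maps into `ℝ × S³` with the same projection to `V` differ by a deck
transformation. -/
theorem exists_lineShift_of_pcov_eq {f g : ℝ × S3 → ℝ × S3} (hf : Continuous f)
    (hg : Continuous g) (h : ∀ q, pcov (f q) = pcov (g q)) :
    ∃ c : ℝ, (∀ q, pcov (lineShift c q) = pcov q) ∧ ∀ q, f q = lineShift c (g q) := by
  obtain ⟨q₀⟩ : Nonempty (ℝ × S3) := inferInstance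
  have h1 : ∀ q, Circle.exp (f q).1 = Circle.exp (g q).1 := fun q => congrArg Prod.fst (h q)
  obtain ⟨k, hk⟩ := Circle.exp_eq_exp.1 (h1 q₀)
  refine ⟨k * (2 * Real.pi), pcov_lineShift k, fun q => ?_⟩
  have key := Circle.isCoveringMap_exp.eq_of_comp_eq (g₁ := fun q => (f q).1)
    (g₂ := fun q => (g q).1 + k * (2 * Real.pi)) (by fun_prop) (by fun_prop)
    (by
      funext q
      simp only [Function.comp_apply]
      rw [Circle.exp_add, Circle.exp_int_mul_two_pi, mul_one, h1]) q₀ hk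
  exact Prod.ext (congrFun key q) (congrArg Prod.snd (h q) :)

/-- A diffeomorphism of `V` homotopic to the identity is covered by a smooth self-map of
`ℝ × S³` moving the line coordinate by a bounded amount. -/
theorem exists_contMDiff_lift {φ : V → V} (hs : ContMDiff IV IV (⊤ : ℕ∞) φ) {hc : Continuous φ}
    (hh : ContinuousMap.Homotopic ⟨φ, hc⟩ (ContinuousMap.id V)) :
    ∃ f : ℝ × S3 → ℝ × S3, ContMDiff IRS IRS (⊤ : ℕ∞) f ∧ (∀ q, pcov (f q) = φ (pcov q)) ∧
      ∃ C : ℝ, ∀ q, |(f q).1 - q.1| ≤ C := by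
  obtain ⟨H⟩ := hh.symm
  let u : C(unitInterval × V, Circle) :=
    ⟨fun x => (H x).1 / x.2.1, by fun_prop⟩
  have hu : ∀ v, u (0, v) = Circle.exp ((ContinuousMap.const V (0 : ℝ)) v) := by
    intro v; simp [u]
  let D := Circle.isCoveringMap_exp.liftHomotopy u (ContinuousMap.const V (0 : ℝ)) hu
  have hD : ∀ v, Circle.exp (D (1, v)) = (φ v).1 / v.1 := by
    intro v
    have := congrFun (Circle.isCoveringMap_exp.liftHomotopy_lifts u _ hu) (1, v)
    exact (this :).trans (by simp [u])
  have hDc : Continuous fun v : V => D (1, v) := by fun_prop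
  have hpc : Continuous pcov := by unfold pcov; fun_prop
  have hps : ContMDiff IRS IV (⊤ : ℕ∞) pcov :=
    ContMDiff.prodMk (contMDiff_circleExp.comp contMDiff_fst) contMDiff_snd
  have hφp := hs.comp hps
  have hexp : ∀ q : ℝ × S3, Circle.exp (q.1 + D (1, pcov q)) = (φ (pcov q)).1 := by
    intro q
    rw [Circle.exp_add, hD]
    simp [pcov]
  obtain ⟨C, hC⟩ := isCompact_univ.exists_bound_of_continuousOn hDc.continuousOn
  refine ⟨fun q => (q.1 + D (1, pcov q), (φ (pcov q)).2), ?_, ?_, C, ?_⟩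
  · refine ContMDiff.prodMk (ContMDiff.of_circleExp_comp ?_ ?_) (contMDiff_snd.comp hφp)
    · exact continuous_fst.add (hDc.comp hpc)
    · simp only [hexp]
      exact contMDiff_fst.comp hφp
  · intro q
    exact Prod.ext (hexp q) rfl
  · intro q
    simpa using hC (pcov q) (mem_univ _)

theorem InDiff0.exists_isLiftU {φ : V → V} (h : InDiff0 φ) : ∃ f, IsLiftU φ f := by
  obtain ⟨⟨hs, ψ, hψ, hl, hr⟩, hc, hh⟩ := h
  have hh' : ContinuousMap.Homotopic ⟨ψ, hψ.continuous⟩ (ContinuousMap.id V) := by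
    have h1 := (ContinuousMap.Homotopic.refl (⟨ψ, hψ.continuous⟩ : C(V, V))).comp hh.symm
    have e : (⟨ψ, hψ.continuous⟩ : C(V, V)).comp ⟨φ, hc⟩ = ContinuousMap.id V :=
      ContinuousMap.ext hl
    rw [e] at h1
    exact h1
  obtain ⟨f, sf, pf, -⟩ := exists_contMDiff_lift hs hh
  obtain ⟨g, sg, pg, -⟩ := exists_contMDiff_lift hψ hh'
  obtain ⟨c, -, hcf⟩ := exists_lineShift_of_pcov_eq (sg.comp sf).continuous continuous_id
    (fun q => by simp [pg, pf, hl (pcov q)])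
  obtain ⟨d, -, hdf⟩ := exists_lineShift_of_pcov_eq (sf.comp sg).continuous continuous_id
    (fun q => by simp [pg, pf, hr (pcov q)])
  have hbij : Function.Bijective f := by
    constructor
    · intro x y hxy
      have := congrArg (fun q => lineShift (-c) (g q)) hxy
      simpa [show ∀ q, g (f q) = lineShift c q from hcf, lineShift_neg_lineShift] using this
    · intro y
      refine ⟨g (lineShift (-d) y), ?_⟩
      rw [show ∀ q, f (g q) = lineShift d q from hdf, lineShift_lineShift_neg]
  have hleft : Function.LeftInverse (fun q => lineShift (-c) (g q)) f := fun q => by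
    simp [show ∀ q, g (f q) = lineShift c q from hcf, lineShift_neg_lineShift]
  exact ⟨f, ⟨sf, _, (contMDiff_lineShift (-c)).comp sg, hleft,
    hleft.rightInverse_of_surjective hbij.2⟩, pf⟩

theorem IsLiftU.exists_bound {φ : V → V} (h : InDiff0 φ) {f : ℝ × S3 → ℝ × S3}
    (hf : IsLiftU φ f) : ∃ C : ℝ, ∀ q, |(f q).1 - q.1| ≤ C := by
  obtain ⟨⟨hs, -⟩, hc, hh⟩ := h
  obtain ⟨g, sg, pg, C, hC⟩ := exists_contMDiff_lift hs hh
  obtain ⟨c, -, hfg⟩ := exists_lineShift_of_pcov_eq hf.1.1.continuous sg.continuous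
    (fun q => by rw [hf.2, pg])
  refine ⟨C + |c|, fun q => ?_⟩
  have : (f q).1 - q.1 = ((g q).1 - q.1) + c := by
    rw [hfg]; simp only [_root_.lineShift]; ring
  rw [this]
  exact (abs_add_le _ _).trans (by gcongr; exact hC q)

/-- If `f` and `g` lift elements of `Diff₀(V)`, then `g⁻¹ ∘ f` preserves the end `+∞`. -/
theorem exists_le_of_isLiftU {φ ψ : V → V} (hφ : InDiff0 φ) (hψ : InDiff0 ψ)
    {f g g' : ℝ × S3 → ℝ × S3} (hf : IsLiftU φ f) (hg : IsLiftU ψ g)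
    (hg' : Function.RightInverse g' g) (b : ℝ) :
    ∃ r : ℝ, ∀ q, r ≤ q.1 → b ≤ (g' (f q)).1 := by
  obtain ⟨C, hC⟩ := hf.exists_bound hφ
  obtain ⟨D, hD⟩ := hg.exists_bound hψ
  refine ⟨b + C + D, fun q hq => ?_⟩
  have h1 := abs_le.1 (hC q)
  have h2 := abs_le.1 (hD (g' (f q)))
  rw [hg' (f q)] at h2
  linarith [h1.1, h2.2]

theorem InDiff0.interpolates_self {φ : V → V} (h : InDiff0 φ) : Interpolates φ φ := by
  obtain ⟨f, hf⟩ := h.exists_isLiftU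
  exact ⟨f, f, f, hf, hf, hf.1, 0, 0, le_rfl, fun _ _ => rfl, fun _ _ => rfl⟩

theorem Interpolates.symm {φ ψ : V → V} (hφ : InDiff0 φ) (hψ : InDiff0 ψ)
    (H : Interpolates φ ψ) : Interpolates ψ φ := by
  obtain ⟨f, g, h, hf, hg, ⟨sh, h', sh', lh, rh⟩, a, b, -, ha, hb⟩ := H
  obtain ⟨g', -, -, rg⟩ := hg.1.2
  obtain ⟨r, hr⟩ := exists_le_of_isLiftU hφ hψ hf hg rg b
  refine ⟨g, f, fun q => g (h' (f q)), hg, hf,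
    hg.1.comp (IsDiffeoB.comp ⟨sh', h, sh, rh, lh⟩ hf.1), a, max a r, le_max_left _ _,
    fun q hq => ?_, fun q hq => ?_⟩
  · simp only [← ha q hq, lh q]
  · have h1 : h (g' (f q)) = f q := by rw [hb _ (hr q ((le_max_right _ _).trans hq)), rg]
    have h2 : h' (f q) = g' (f q) := by rw [← h1, lh, h1]
    simp only [h2, rg (f q)]

theorem Interpolates.trans {φ ψ χ : V → V} (hψ : InDiff0 ψ) (hχ : InDiff0 χ)
    (H₁ : Interpolates φ ψ) (H₂ : Interpolates ψ χ) : Interpolates φ χ := by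
  obtain ⟨f, g, h₁, hf, hg, dh₁, a₁, b₁, -, ha₁, hb₁⟩ := H₁
  obtain ⟨k, l, h₂, hk, hl, dh₂, a₂, b₂, -, ha₂, hb₂⟩ := H₂
  obtain ⟨c, hc, hgk⟩ := exists_lineShift_of_pcov_eq hg.1.1.continuous hk.1.1.continuous
    (fun q => by rw [hg.2, hk.2])
  obtain ⟨sg, g', sg', lg, rg⟩ := hg.1
  have hl' := hl.lineShift hc
  obtain ⟨r, hr⟩ := exists_le_of_isLiftU hχ hψ hl' hg rg b₁
  refine ⟨f, _, fun q => h₁ (g' (lineShift c (h₂ q))), hf, hl',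
    dh₁.comp (IsDiffeoB.comp ⟨sg', g, sg, rg, lg⟩ ((isDiffeoB_lineShift c).comp dh₂)),
    min a₁ a₂, max (min a₁ a₂) (max b₂ r), le_max_left _ _, fun q hq => ?_, fun q hq => ?_⟩
  · simp only [ha₂ q (hq.trans (min_le_right _ _)), ← hgk, lg q]
    exact ha₁ q (hq.trans (min_le_left _ _))
  · have hq' := max_le_iff.1 ((le_max_right _ _).trans hq)
    simp only [hb₂ q hq'.1]
    rw [hb₁ _ (hr q hq'.2), rg]

/-- Interpolation is an equivalence relation on `Diff₀(V)`. -/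
theorem interpolation_is_equivalence :
    (∀ φ : V → V, InDiff0 φ → Interpolates φ φ) ∧
    (∀ φ ψ : V → V, InDiff0 φ → InDiff0 ψ → Interpolates φ ψ → Interpolates ψ φ) ∧
    (∀ φ ψ χ : V → V, InDiff0 φ → InDiff0 ψ → InDiff0 χ →
      Interpolates φ ψ → Interpolates ψ χ → Interpolates φ χ) := by
  exact ⟨fun _ h => h.interpolates_self, fun _ _ hφ hψ H => H.symm hφ hψ,
    fun _ _ _ _ hψ hχ H₁ H₂ => H₁.trans hψ hχ H₂⟩

end
end

section
/- If Σ₀ and Σ₁ are smoothly embedded 3-spheres in ℝ × S³ that are smoothly ambiently isotopic, then they are smoothly ambiently isotopic by a compactly supported isotopy: there exist a smooth ambient isotopy F of ℝ × S³ with (F 1) '' Σ₀ = Σ₁ and a compact set K ⊆ ℝ × S³ such that F t z = z for all t ∈ ℝ and all z ∉ K. (The compact-support claim used in the proof of Proposition 1.9 of the paper.) -/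
open scoped Manifold
open Metric Set Module

noncomputable section

/-- A smoothly embedded 3-sphere in `ℝ × S³`. -/
def IsEmbeddedS3inRS (P : Set (ℝ × S3)) : Prop :=
  ∃ f : S3 → ℝ × S3, IsS3Embedding IRS f ∧ Set.range f = P

section Generic

open scoped Topology ContDiff

variable {E H M : Type*} [NormedAddCommGroup E] [NormedSpace ℝ E]
  [TopologicalSpace H] {I : ModelWithCorners ℝ E H} [TopologicalSpace M] [ChartedSpace H M]

theorem ContMDiff.contDiffOn_extChartAt_symm_prod [I.Boundaryless] [IsManifold I ∞ M]
    {f : M × ℝ → ℝ} (hf : ContMDiff (I.prod 𝓘(ℝ, ℝ)) 𝓘(ℝ, ℝ) ∞ f) (x : M) :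
    ContDiffOn ℝ ∞ (fun p : E × ℝ => f ((extChartAt I x).symm p.1, p.2))
      ((extChartAt I x).target ×ˢ univ) := by
  rw [← contMDiffOn_iff_contDiffOn]
  refine hf.comp_contMDiffOn (ContMDiffOn.prodMk ?_ contDiff_snd.contMDiff.contMDiffOn)
  exact (contMDiffOn_extChartAt_symm x).comp contDiff_fst.contMDiff.contMDiffOn fun p hp => hp.1

/-- The derivative in a real variable of a smooth function is jointly continuous. -/
theorem ContMDiff.continuous_deriv_snd [I.Boundaryless] [IsManifold I ∞ M]
    {f : M × ℝ → ℝ} (hf : ContMDiff (I.prod 𝓘(ℝ, ℝ)) 𝓘(ℝ, ℝ) ∞ f) :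
    Continuous fun p : M × ℝ => deriv (fun t => f (p.1, t)) p.2 := by
  rw [continuous_iff_continuousAt]
  rintro ⟨x, t⟩
  set φ := extChartAt I x
  have hopen : IsOpen (φ.target ×ˢ (univ : Set ℝ)) := (isOpen_extChartAt_target x).prod isOpen_univ
  set g : E × ℝ → ℝ := fun p => f (φ.symm p.1, p.2) with hg_def
  have hg : ContDiffOn ℝ ∞ g (φ.target ×ˢ univ) := hf.contDiffOn_extChartAt_symm_prod x
  have hc : ContinuousOn (fun p => fderiv ℝ g p (0, 1)) (φ.target ×ˢ univ) :=
    (hg.continuousOn_fderiv_of_isOpen hopen (by simp)).clm_apply continuousOn_const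
  have hx : φ x ∈ φ.target := mem_extChartAt_target x
  have hcx : ContinuousAt (fun p => fderiv ℝ g p (0, 1)) (φ x, t) :=
    hc.continuousAt (hopen.mem_nhds ⟨hx, mem_univ _⟩)
  have hchart : ContinuousAt (fun p : M × ℝ => (φ p.1, p.2)) (x, t) :=
    ((continuousAt_extChartAt x).comp_of_eq continuousAt_fst rfl).prodMk continuousAt_snd
  refine (ContinuousAt.comp (f := fun p : M × ℝ => (φ p.1, p.2)) hcx hchart).congr ?_
  have hsrc : ∀ᶠ p : M × ℝ in 𝓝 (x, t), p.1 ∈ φ.source :=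
    continuousAt_fst.eventually (extChartAt_source_mem_nhds x)
  filter_upwards [hsrc] with p hp
  have hd : DifferentiableAt ℝ g (φ p.1, p.2) :=
    (hg.contDiffAt (hopen.mem_nhds ⟨φ.map_source hp, mem_univ _⟩)).differentiableAt (by simp)
  have hline : HasDerivAt (fun s : ℝ => (φ p.1, s)) ((0 : E), (1 : ℝ)) p.2 :=
    (hasDerivAt_const _ _).prodMk (hasDerivAt_id _)
  have := (hd.hasFDerivAt.comp_hasDerivAt p.2 hline).deriv
  simp only [Function.comp_def, hg_def, φ.left_inv hp] at this
  simpa using this.symm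

/-- If a smooth function `f (x, t)` has, for each `x`, a unique zero `T x`, at which its derivative
in `t` does not vanish, then `T` is smooth. -/
theorem ContMDiff.of_unique_zero [CompleteSpace E] [I.Boundaryless] [IsManifold I ∞ M]
    {f : M × ℝ → ℝ} (hf : ContMDiff (I.prod 𝓘(ℝ, ℝ)) 𝓘(ℝ, ℝ) ∞ f) {T : M → ℝ}
    (hT : ∀ x t, f (x, t) = 0 ↔ T x = t)
    (hd : ∀ x, deriv (fun t => f (x, t)) (T x) ≠ 0) :
    ContMDiff I 𝓘(ℝ, ℝ) ∞ T := by
  intro x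
  set φ := extChartAt I x
  have hopen : IsOpen (φ.target ×ˢ (univ : Set ℝ)) := (isOpen_extChartAt_target x).prod isOpen_univ
  set g : E × ℝ → ℝ := fun p => f (φ.symm p.1, p.2) with hg_def
  have hx : φ x ∈ φ.target := mem_extChartAt_target x
  have hφx : φ.symm (φ x) = x := extChartAt_to_inv x
  have hg : ContDiffAt ℝ ∞ g (φ x, T x) :=
    (hf.contDiffOn_extChartAt_symm_prod x).contDiffAt (hopen.mem_nhds ⟨hx, mem_univ _⟩)
  have hline : HasDerivAt (fun s : ℝ => (φ x, s)) ((0 : E), (1 : ℝ)) (T x) :=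
    (hasDerivAt_const _ _).prodMk (hasDerivAt_id _)
  have hderiv := ((hg.differentiableAt (by simp)).hasFDerivAt.comp_hasDerivAt (T x) hline).deriv
  simp only [Function.comp_def, hg_def, hφx] at hderiv
  have hne : fderiv ℝ g (φ x, T x) (0, 1) ≠ 0 := hderiv ▸ hd x
  have hinv : (fderiv ℝ g (φ x, T x) ∘L .inr ℝ E ℝ).IsInvertible := by
    refine ⟨ContinuousLinearEquiv.unitsEquivAut ℝ (Units.mk0 _ hne), ?_⟩
    ext
    simp
  have hsm := hg.contDiffAt_implicitFunction (by simp) hinv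
  have hzero : g (φ x, T x) = 0 := by simp [hg_def, hφx, hT]
  have heq : T ∘ φ.symm =ᶠ[𝓝 (φ x)] hg.implicitFunction (by simp) hinv := by
    filter_upwards [hg.eventually_apply_implicitFunction (by simp) hinv] with e he
    rw [hzero] at he
    exact (hT _ _).1 he
  rw [contMDiffAt_iff_source, I.range_eq_univ, contMDiffWithinAt_univ, contMDiffAt_iff_contDiffAt]
  exact hsm.congr_of_eventuallyEq heq

/-- A short piece of an ambient isotopy can be cut off, near a moving subset, to an isotopy
supported in a moving compact set. -/
theorem exists_cutoff_step [CompleteSpace E] [I.Boundaryless] [IsManifold I ∞ M] [T2Space M]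
    {F G : ℝ → M → M} (hFG : ∀ t, Function.LeftInverse (G t) (F t) ∧
      Function.RightInverse (G t) (F t))
    (hF : ContMDiff (𝓘(ℝ, ℝ).prod I) I ∞ (fun q : ℝ × M => F q.1 q.2))
    (hG : ContMDiff (𝓘(ℝ, ℝ).prod I) I ∞ (fun q : ℝ × M => G q.1 q.2))
    {η : M → ℝ} (hη : ContMDiff I 𝓘(ℝ, ℝ) ∞ η) (hηI : ∀ x, η x ∈ Icc (0 : ℝ) 1)
    (hηc : HasCompactSupport η) :
    ∃ δ > 0, ∀ a ε : ℝ, 0 ≤ a → 0 ≤ ε → ε ≤ δ → a + ε ≤ 1 →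
      ∃ Φ : ℝ → M → M, IsAmbientIsotopy I Φ ∧
        (∀ x, η x = 1 → Φ 1 (F a x) = F (a + ε) x) ∧
        ∃ K, IsCompact K ∧ ∀ t, ∀ z ∉ K, Φ t z = z := by
  have hu : ContMDiff (I.prod 𝓘(ℝ, ℝ)) 𝓘(ℝ, ℝ) ∞ (fun p : M × ℝ => η (G p.2 p.1)) :=
    hη.comp (hG.comp (contMDiff_snd.prodMk contMDiff_fst))
  have hF' (a : ℝ) : ContMDiff I I ∞ (F a) := hF.comp (contMDiff_const.prodMk contMDiff_id)
  have hG' (a : ℝ) : ContMDiff I I ∞ (G a) := hG.comp (contMDiff_const.prodMk contMDiff_id)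
  have hdiff (w : M) : Differentiable ℝ fun t => η (G t w) := by
    have : ContMDiff 𝓘(ℝ, ℝ) 𝓘(ℝ, ℝ) ∞ fun t => η (G t w) :=
      hu.comp (contMDiff_const.prodMk contMDiff_id)
    exact this.contDiff.differentiable (by simp)
  obtain ⟨C, hC0, hC⟩ : ∃ C : ℝ, 0 ≤ C ∧ ∀ w, ∀ t ∈ Icc (0 : ℝ) 1, ‖deriv (fun t => η (G t w)) t‖ ≤ C := by
    set W : Set M := (fun q : ℝ × M => F q.1 q.2) '' (Icc (-1) 2 ×ˢ tsupport η)
    have hW : IsCompact W := (isCompact_Icc.prod hηc).image hF.continuous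
    obtain ⟨C, hC⟩ := (hW.prod (isCompact_Icc (a := (0 : ℝ)) (b := 1))).exists_bound_of_continuousOn
      hu.continuous_deriv_snd.continuousOn
    refine ⟨max C 0, le_max_right _ _, fun w t ht => ?_⟩
    by_cases hw : w ∈ W
    · exact (hC (w, t) ⟨hw, ht⟩).trans (le_max_left _ _)
    · have hz : (fun t => η (G t w)) =ᶠ[𝓝 t] fun _ => 0 := by
        filter_upwards [Icc_mem_nhds (a := -1) (b := 2) (by linarith [ht.1]) (by linarith [ht.2])]
          with s hs
        by_contra hne
        exact hw ⟨(s, G s w), ⟨hs, subset_tsupport _ hne⟩, (hFG s).2 w⟩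
      rw [hz.deriv_eq]
      simp
  refine ⟨1 / (C + 1), by positivity, fun a ε ha hε hεδ haε => ?_⟩
  set σ := Real.smoothTransition
  have hεC : ε * C < 1 := by
    rw [le_div_iff₀ (by positivity)] at hεδ
    rcases hε.eq_or_lt with rfl | hε
    · simp
    · nlinarith
  let f : (ℝ × M) × ℝ → ℝ := fun p => p.2 - (a + ε * σ p.1.1 * η (G p.2 p.1.2))
  have hσ : ContMDiff 𝓘(ℝ, ℝ) 𝓘(ℝ, ℝ) ∞ σ := Real.smoothTransition.contDiff.contMDiff
  have hf : ContMDiff ((𝓘(ℝ, ℝ).prod I).prod 𝓘(ℝ, ℝ)) 𝓘(ℝ, ℝ) ∞ f := by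
    have h1 : ContMDiff ((𝓘(ℝ, ℝ).prod I).prod 𝓘(ℝ, ℝ)) 𝓘(ℝ, ℝ) ∞
        fun p : (ℝ × M) × ℝ => η (G p.2 p.1.2) :=
      hu.comp ((contMDiff_snd.comp contMDiff_fst).prodMk contMDiff_snd)
    have h2 : ContMDiff ((𝓘(ℝ, ℝ).prod I).prod 𝓘(ℝ, ℝ)) 𝓘(ℝ, ℝ) ∞
        fun p : (ℝ × M) × ℝ => σ p.1.1 :=
      hσ.comp (contMDiff_fst.comp contMDiff_fst)
    exact contMDiff_snd.sub (contMDiff_const.add ((contMDiff_const.mul h2).mul h1))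
  have hσI (s : ℝ) : σ s ∈ Icc (0 : ℝ) 1 :=
    ⟨Real.smoothTransition.nonneg s, Real.smoothTransition.le_one s⟩
  have hshift (s : ℝ) (x : M) : ε * σ s * η x ∈ Icc 0 ε := by
    obtain ⟨h1, h2⟩ := hσI s
    obtain ⟨h3, h4⟩ := hηI x
    refine ⟨by positivity, ?_⟩
    calc ε * σ s * η x ≤ ε * 1 * 1 := by gcongr
      _ = ε := by ring
  have hzero {q : ℝ × M} {t : ℝ} (h : f (q, t) = 0) : t ∈ Icc (0 : ℝ) 1 := by
    have := hshift q.1 (G t q.2)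
    simp only [f] at h
    exact ⟨by linarith [this.1], by linarith [this.2]⟩
  have hfd (q : ℝ × M) (t : ℝ) : HasDerivAt (fun t => f (q, t))
      (1 - ε * σ q.1 * deriv (fun t => η (G t q.2)) t) t :=
    (hasDerivAt_id t).sub (((hdiff q.2 t).hasDerivAt.const_mul (ε * σ q.1)).const_add a)
  have hpos (q : ℝ × M) (t : ℝ) (ht : t ∈ Icc (0 : ℝ) 1) :
      0 < 1 - ε * σ q.1 * deriv (fun t => η (G t q.2)) t := by
    obtain ⟨h1, h2⟩ := hσI q.1
    have h3 := (le_abs_self _).trans (hC q.2 t ht)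
    have : ε * σ q.1 * deriv (fun t => η (G t q.2)) t ≤ ε * 1 * C := by
      calc _ ≤ ε * σ q.1 * C := by gcongr
        _ ≤ _ := by gcongr
    linarith
  have hcont (q : ℝ × M) : Continuous fun t => f (q, t) :=
    continuous_iff_continuousAt.2 fun t => (hfd q t).continuousAt
  have hmono (q : ℝ × M) : StrictMonoOn (fun t => f (q, t)) (Icc 0 1) := by
    refine strictMonoOn_of_deriv_pos (convex_Icc 0 1) (hcont q).continuousOn fun t ht => ?_
    rw [(hfd q t).deriv]
    exact hpos q t (interior_subset ht)
  have hroot (q : ℝ × M) : ∃ t, f (q, t) = 0 := by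
    have h1 := hshift q.1 (G a q.2)
    have h2 := hshift q.1 (G (a + ε) q.2)
    have := intermediate_value_Icc (by linarith : a ≤ a + ε) (hcont q).continuousOn
    obtain ⟨t, -, ht⟩ := this (show (0 : ℝ) ∈ Icc _ _ from
      ⟨by simp only [f]; linarith [h1.1], by simp only [f]; linarith [h2.2]⟩)
    exact ⟨t, ht⟩
  choose T hT using hroot
  have hTiff (q : ℝ × M) (t : ℝ) : f (q, t) = 0 ↔ T q = t := by
    refine ⟨fun h => (hmono q).injOn (hzero (hT q)) (hzero h) ((hT q).trans h.symm), ?_⟩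
    rintro rfl
    exact hT q
  have hTs : ContMDiff (𝓘(ℝ, ℝ).prod I) 𝓘(ℝ, ℝ) ∞ T := by
    refine hf.of_unique_zero hTiff fun q => ?_
    rw [(hfd q _).deriv]
    exact (hpos q _ (hzero (hT q))).ne'
  let Φ : ℝ → M → M := fun s z => F (a + ε * σ s * η (G a z)) (G a z)
  let Ψ : ℝ → M → M := fun s w => F a (G (T (s, w)) w)
  have hΨΦ (s : ℝ) : Function.LeftInverse (Ψ s) (Φ s) := fun z => by
    have : T (s, Φ s z) = a + ε * σ s * η (G a z) := by
      rw [← hTiff]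
      simp [f, Φ, (hFG _).1 (G a z)]
    simp only [Ψ, this]
    simp only [Φ, (hFG _).1 (G a z), (hFG a).2 z]
  have hΦΨ (s : ℝ) : Function.RightInverse (Ψ s) (Φ s) := fun w => by
    have : a + ε * σ s * η (G (T (s, w)) w) = T (s, w) := by
      have := hT (s, w)
      simp only [f] at this
      linarith
    simp only [Φ, Ψ, (hFG a).1 (G (T (s, w)) w), this, (hFG _).2 w]
  refine ⟨Φ, ⟨?_, fun s => ⟨(hΨΦ s).injective, (hΦΨ s).surjective⟩, ?_, Ψ,
    fun s => ⟨hΨΦ s, hΦΨ s⟩, ?_⟩, fun x hx => ?_, F a '' tsupport η,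
    hηc.image (hF' a).continuous, fun t z hz => ?_⟩
  · ext z
    simp [Φ, σ, (hFG a).2 z]
  · have h1 : ContMDiff (𝓘(ℝ, ℝ).prod I) I ∞ fun q : ℝ × M => G a q.2 :=
      (hG' a).comp contMDiff_snd
    exact hF.comp ((contMDiff_const.add
      ((contMDiff_const.mul (hσ.comp contMDiff_fst)).mul (hη.comp h1))).prodMk h1)
  · exact (hF' a).comp (hG.comp (hTs.prodMk contMDiff_snd))
  · simp [Φ, σ, (hFG a).1 x, hx]
  · have : η (G a z) = 0 := by
      by_contra hne
      exact hz ⟨G a z, subset_tsupport _ hne, (hFG a).2 z⟩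
    simp [Φ, this, (hFG a).2 z]

theorem IsAmbientIsotopy.comp {Φ Ψ : ℝ → M → M} (hΦ : IsAmbientIsotopy I Φ)
    (hΨ : IsAmbientIsotopy I Ψ) : IsAmbientIsotopy I fun t => Φ t ∘ Ψ t := by
  obtain ⟨h0, hb, hs, Φ', hi, hs'⟩ := hΦ
  obtain ⟨k0, kb, ks, Ψ', ki, ks'⟩ := hΨ
  exact ⟨by simp [h0, k0], fun t => (hb t).comp (kb t), hs.comp (contMDiff_fst.prodMk ks),
    fun t => Ψ' t ∘ Φ' t,
    fun t => ⟨(hi t).1.comp (ki t).1, (hi t).2.comp (ki t).2⟩,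
    ks'.comp (contMDiff_fst.prodMk hs')⟩

theorem isAmbientIsotopy_id : IsAmbientIsotopy I fun _ : ℝ => (id : M → M) :=
  ⟨rfl, fun _ => Function.bijective_id, contMDiff_snd, fun _ => id,
    fun _ => ⟨fun _ => rfl, fun _ => rfl⟩, contMDiff_snd⟩

/-- An ambient isotopy can be replaced by a compactly supported one with the same effect on the
set where a given compactly supported smooth function equals `1`. -/
theorem IsAmbientIsotopy.exists_compactSupport [CompleteSpace E] [I.Boundaryless]
    [IsManifold I ∞ M] [T2Space M] {F : ℝ → M → M} (hF : IsAmbientIsotopy I F)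
    {η : M → ℝ} (hη : ContMDiff I 𝓘(ℝ, ℝ) ∞ η) (hηI : ∀ x, η x ∈ Icc (0 : ℝ) 1)
    (hηc : HasCompactSupport η) :
    ∃ Φ : ℝ → M → M, IsAmbientIsotopy I Φ ∧ (∀ x, η x = 1 → Φ 1 x = F 1 x) ∧
      ∃ K, IsCompact K ∧ ∀ t, ∀ z ∉ K, Φ t z = z := by
  obtain ⟨h0, -, hs, G, hFG, hG⟩ := hF
  obtain ⟨δ, hδ, hstep⟩ := exists_cutoff_step hFG hs hG hη hηI hηc
  obtain ⟨n, hn⟩ := exists_nat_one_div_lt hδ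
  have hn0 : (0 : ℝ) < n + 1 := by positivity
  have key (k : ℕ) (hk : k ≤ n + 1) : ∃ Φ : ℝ → M → M, IsAmbientIsotopy I Φ ∧
      (∀ x, η x = 1 → Φ 1 x = F (k * (1 / (n + 1))) x) ∧
      ∃ K, IsCompact K ∧ ∀ t, ∀ z ∉ K, Φ t z = z := by
    induction k with
    | zero => exact ⟨_, isAmbientIsotopy_id, by simp [h0], ∅, isCompact_empty, by simp⟩
    | succ k ih =>
      obtain ⟨Φ, hΦ, hΦ1, K, hK, hΦK⟩ := ih (by omega)
      have hk' : (k : ℝ) + 1 ≤ n + 1 := by exact_mod_cast hk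
      have hsum : (k : ℝ) * (1 / (n + 1)) + 1 / (n + 1) ≤ 1 := by
        rw [← add_one_mul, mul_one_div, div_le_one hn0]
        exact hk'
      obtain ⟨Ψ, hΨ, hΨ1, L, hL, hΨL⟩ :=
        hstep (k * (1 / (n + 1))) (1 / (n + 1)) (by positivity) (by positivity) hn.le hsum
      refine ⟨_, hΨ.comp hΦ, fun x hx => ?_, K ∪ L, hK.union hL, fun t z hz => ?_⟩
      · simp only [Function.comp_apply, hΦ1 x hx, hΨ1 x hx]
        congr 1
        push_cast
        ring
      · simp only [mem_union, not_or] at hz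
        simp only [Function.comp_apply, hΦK t z hz.1, hΨL t z hz.2]
  obtain ⟨Φ, hΦ, hΦ1, hK⟩ := key (n + 1) le_rfl
  refine ⟨Φ, hΦ, fun x hx => ?_, hK⟩
  rw [hΦ1 x hx]
  congr 1
  push_cast
  field_simp

end Generic

/-- Ambiently isotopic embedded 3-spheres in `ℝ × S³` are isotopic by a compactly supported
ambient isotopy. -/
theorem compactly_supported_isotopy (A₀ A₁ : Set (ℝ × S3))
    (h₀ : IsEmbeddedS3inRS A₀) (h₁ : IsEmbeddedS3inRS A₁)
    (h : AmbIsotopic IRS A₀ A₁) :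
    ∃ F : ℝ → (ℝ × S3) → (ℝ × S3), IsAmbientIsotopy IRS F ∧ (F 1) '' A₀ = A₁ ∧
      ∃ K : Set (ℝ × S3), IsCompact K ∧ ∀ t : ℝ, ∀ z : ℝ × S3, z ∉ K → F t z = z := by
  obtain ⟨F, hF, rfl⟩ := h
  obtain ⟨f, ⟨hf, -⟩, rfl⟩ := h₀
  have hcomp : IsCompact (range f) := isCompact_range hf.continuous
  obtain ⟨R, hR⟩ := (hcomp.image continuous_fst).isBounded.subset_closedBall 0
  let b : ContDiffBump (0 : ℝ) :=
    ⟨max R 1, max R 1 + 1, by positivity, by linarith⟩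
  have hbs : ContMDiff IRS 𝓘(ℝ, ℝ) (⊤ : ℕ∞) fun z : ℝ × S3 => b z.1 :=
    b.contDiff.contMDiff.comp contMDiff_fst
  have hbc : HasCompactSupport fun z : ℝ × S3 => b z.1 := by
    refine HasCompactSupport.intro (K := tsupport b ×ˢ univ)
      (b.hasCompactSupport.isCompact.prod isCompact_univ) fun z hz => ?_
    exact image_eq_zero_of_notMem_tsupport fun h => hz ⟨h, mem_univ _⟩
  obtain ⟨Φ, hΦ, hΦ1, hK⟩ :=
    hF.exists_compactSupport hbs (fun z => ⟨b.nonneg, b.le_one⟩) hbc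
  refine ⟨Φ, hΦ, image_congr fun z hz => hΦ1 z ?_, hK⟩
  exact b.one_of_mem_closedBall
    (closedBall_subset_closedBall (le_max_left _ _) (hR (mem_image_of_mem _ hz)))

end
end
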